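/- For a ∈ (0,a*) let u_a be a minimizer of e(a), ε_a = (∫_{ℝ²}|∇|u_a||² dx)^{−1/2}, x_a a global maximum point of |u_a|, and w_a(x) = ε_a u_a(ε_a x + x_a) e^{−i((ε_a Ω/2) x·x_a^⊥ − θ_a)} for any θ_a ∈ [0,2π). Then there exists a constant η > 0, independent of a, such that ∫_{B₂(0)} |w_a(x)|² dx ≥ η for all a sufficiently close to a*. -/

import Mathlib

open MeasureTheory Filter Topology Set Metric

noncomputable section

/-- The plane `ℝ²` with the Euclidean norm. -/
abbrev Plane : Type := EuclideanSpace ℝ (Fin 2)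

def e0 : Plane := EuclideanSpace.single (0 : Fin 2) (1 : ℝ)
def e1 : Plane := EuclideanSpace.single (1 : Fin 2) (1 : ℝ)

/-- Partial derivatives of a complex-valued function. -/
def d0 (u : Plane → ℂ) (x : Plane) : ℂ := fderiv ℝ u x e0
def d1 (u : Plane → ℂ) (x : Plane) : ℂ := fderiv ℝ u x e1

/-- `|∇u|²` for complex-valued `u`. -/
def gradSq (u : Plane → ℂ) (x : Plane) : ℝ := ‖d0 u x‖ ^ 2 + ‖d1 u x‖ ^ 2

/-- `|∇|u||²`. -/
def gradAbsSq (u : Plane → ℂ) (x : Plane) : ℝ := ‖fderiv ℝ (fun y => ‖u y‖) x‖ ^ 2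

/-- Membership in `H¹(ℝ², ℂ)` (smooth-representative formulation). -/
def InH1 (u : Plane → ℂ) : Prop :=
  Differentiable ℝ u ∧ Integrable (fun x => ‖u x‖ ^ 2) ∧ Integrable (gradSq u)

/-- Membership in the space `𝓗 = {u ∈ H¹ : ∫ V |u|² < ∞}`. -/
def InH (V : Plane → ℝ) (u : Plane → ℂ) : Prop :=
  InH1 u ∧ Integrable (fun x => V x * ‖u x‖ ^ 2)

/-- The constraint set `S_a`. -/
def Sset (V : Plane → ℝ) (a : ℝ) : Set (Plane → ℂ) :=
  {u | InH V u ∧ (∫ x : Plane, ‖u x‖ ^ 2) = a}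

/-- The momentum density `x^⊥ · (iu, ∇u)`, with `x^⊥ = (-x₂, x₁)` and
`(iu,∇u)_j = Im(ū ∂_j u)`. -/
def momentum (u : Plane → ℂ) (x : Plane) : ℝ :=
  (-(x 1)) * ((starRingEnd ℂ) (u x) * d0 u x).im + (x 0) * ((starRingEnd ℂ) (u x) * d1 u x).im

/-- The logarithmic convolution term `∫∫ ln|x-y| |u(x)|²|u(y)|²`. -/
def logConv (u : Plane → ℂ) : ℝ :=
  ∫ x : Plane, ∫ y : Plane, Real.log ‖x - y‖ * ‖u x‖ ^ 2 * ‖u y‖ ^ 2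

/-- The energy functional `E_a`. -/
def Ea (V : Plane → ℝ) (Ω : ℝ) (u : Plane → ℂ) : ℝ :=
  (∫ x : Plane, (gradSq u x + V x * ‖u x‖ ^ 2)) + (1 / 2) * logConv u
    - (1 / 2) * (∫ x : Plane, ‖u x‖ ^ 4) - Ω * (∫ x : Plane, momentum u x)

/-- `u` is a minimizer of `e(a) = inf_{S_a} E_a`. -/
def IsMinimizer (V : Plane → ℝ) (Ω a : ℝ) (u : Plane → ℂ) : Prop :=
  u ∈ Sset V a ∧ ∀ v ∈ Sset V a, Ea V Ω u ≤ Ea V Ω v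

/-- `e(a) = inf_{u ∈ S_a} E_a(u)`. -/
def eInf (V : Plane → ℝ) (Ω a : ℝ) : ℝ := sInf (Ea V Ω '' Sset V a)

/-- `f(x) → ∞` as `|x| → ∞`. -/
def TendsInfty (f : Plane → ℝ) : Prop := ∀ M : ℝ, ∃ R : ℝ, ∀ x : Plane, R ≤ ‖x‖ → M ≤ f x

/-- Hypotheses (1.10): `0 ≤ V ∈ L^∞_loc` and `liminf_{|x|→∞} V(x)/|x|² > 0`. -/
def V110 (V : Plane → ℝ) : Prop :=
  Measurable V ∧ (∀ x, 0 ≤ V x) ∧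
  (∀ R : ℝ, ∃ C : ℝ, ∀ x : Plane, ‖x‖ ≤ R → V x ≤ C) ∧
  (∃ c : ℝ, 0 < c ∧ ∃ R : ℝ, ∀ x : Plane, R ≤ ‖x‖ → c * ‖x‖ ^ 2 ≤ V x)

/-- The set of rotational velocities `W > 0` with `V(x) - (W²/4)|x|² → ∞`;
`Ω* = sup RotSet V`. -/
def RotSet (V : Plane → ℝ) : Set ℝ :=
  {W : ℝ | 0 < W ∧ TendsInfty (fun x => V x - W ^ 2 / 4 * ‖x‖ ^ 2)}

/-- `Ω < Ω*` where `Ω* = sup RotSet V` (possibly `+∞`). -/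
def SubCritical (V : Plane → ℝ) (Ω : ℝ) : Prop := ∃ W ∈ RotSet V, Ω < W

def d0R (q : Plane → ℝ) (x : Plane) : ℝ := fderiv ℝ q x e0
def d1R (q : Plane → ℝ) (x : Plane) : ℝ := fderiv ℝ q x e1

/-- `|∇q|²` for real-valued `q`. -/
def gradSqR (q : Plane → ℝ) (x : Plane) : ℝ := (d0R q x) ^ 2 + (d1R q x) ^ 2

/-- The Laplacian of a real-valued function. -/
def lapR (q : Plane → ℝ) (x : Plane) : ℝ := fderiv ℝ (d0R q) x e0 + fderiv ℝ (d1R q) x e1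

/-- `Q` is the positive radially symmetric `H¹` solution of `-ΔQ + Q - Q³ = 0` on `ℝ²`. -/
def IsGroundState (Q : Plane → ℝ) : Prop :=
  ContDiff ℝ 2 Q ∧ (∀ x, 0 < Q x) ∧ (∀ x y : Plane, ‖x‖ = ‖y‖ → Q x = Q y) ∧
  Integrable (fun x => (Q x) ^ 2) ∧ Integrable (fun x => ‖fderiv ℝ Q x‖ ^ 2) ∧
  (∀ x, - lapR Q x + Q x - (Q x) ^ 3 = 0)

/-- The Laplacian of a complex-valued function. -/
def lapC (u : Plane → ℂ) (x : Plane) : ℂ := fderiv ℝ (d0 u) x e0 + fderiv ℝ (d1 u) x e1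

/-- The Euler–Lagrange equation (1.18):
`-Δu + V u + (∫ ln|x-y||u(y)|² dy) u + iΩ (x^⊥·∇u) = μ u + |u|² u`. -/
def EulerLagrange (V : Plane → ℝ) (Ω : ℝ) (u : Plane → ℂ) (μ : ℝ) : Prop :=
  ∀ x : Plane,
    - lapC u x + (V x : ℂ) * u x
      + (((∫ y : Plane, Real.log ‖x - y‖ * ‖u y‖ ^ 2) : ℝ) : ℂ) * u x
      + Complex.I * (Ω : ℂ) * (((-(x 1) : ℝ) : ℂ) * d0 u x + ((x 0 : ℝ) : ℂ) * d1 u x)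
    = (μ : ℂ) * u x + ((‖u x‖ ^ 2 : ℝ) : ℂ) * u x

/-- Condition (V): `0 ≤ V_Ω ∈ C^α_loc`, `V_Ω` vanishes only at the origin, and `V` has at
most exponential growth. Here `V_Ω(x) = V(x) - (Ω²/4)|x|²`. -/
def CondV (V : Plane → ℝ) (Ω α : ℝ) : Prop :=
  α ∈ Ioo (0 : ℝ) 1 ∧
  (∀ x : Plane, 0 ≤ V x - Ω ^ 2 / 4 * ‖x‖ ^ 2) ∧
  (∀ x : Plane, V x - Ω ^ 2 / 4 * ‖x‖ ^ 2 = 0 ↔ x = 0) ∧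
  (∀ R : ℝ, 0 < R → ∃ C : ℝ, ∀ x ∈ closedBall (0 : Plane) R, ∀ y ∈ closedBall (0 : Plane) R,
    |(V x - Ω ^ 2 / 4 * ‖x‖ ^ 2) - (V y - Ω ^ 2 / 4 * ‖y‖ ^ 2)| ≤ C * ‖x - y‖ ^ α) ∧
  (∃ C γ : ℝ, 0 < γ ∧ ∀ x : Plane, V x ≤ C * Real.exp (γ * ‖x‖))

/-- `ε_a = (∫ |∇|u_a||²)^{-1/2}` for a family of minimizers. -/
def epsOf (u : ℝ → Plane → ℂ) (a : ℝ) : ℝ :=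
  (∫ x : Plane, gradAbsSq (u a) x) ^ (-(1 : ℝ) / 2)

/-- The rescaled family
`w_a(y) = ε_a u_a(ε_a y + x_a) e^{-i((ε_a Ω/2) y·x_a^⊥ - θ)}`. -/
def wfam (Ω : ℝ) (u : ℝ → Plane → ℂ) (xa : ℝ → Plane) (a θv : ℝ) (y : Plane) : ℂ :=
  ((epsOf u a : ℝ) : ℂ) * u a ((epsOf u a) • y + xa a) *
    Complex.exp (-Complex.I *
      ((((epsOf u a * Ω / 2) * (-(y 0) * (xa a 1) + (y 1) * (xa a 0)) - θv) : ℝ) : ℂ))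

/-- The limit profile `(1/√a*) Q(x/√a*)` where `a* = ‖Q‖₂²`. -/
def Qstar (Q : Plane → ℝ) (x : Plane) : ℝ :=
  (Real.sqrt (∫ y : Plane, (Q y) ^ 2))⁻¹ * Q ((Real.sqrt (∫ y : Plane, (Q y) ^ 2))⁻¹ • x)

section Bump

open scoped RealInnerProductSpace

theorem hasDerivAt_posPart_sq (t : ℝ) :
    HasDerivAt (fun t : ℝ => max t 0 ^ 2) (2 * max t 0) t := by
  rcases lt_trichotomy t 0 with h | rfl | h
  · rw [max_eq_right h.le, mul_zero]
    refine (hasDerivAt_const t (0 : ℝ)).congr_of_eventuallyEq ?_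
    filter_upwards [gt_mem_nhds h] with x hx
    simp [max_eq_right hx.le]
  · have hO : (fun t : ℝ => max t 0 ^ 2) =O[𝓝 0] fun t => ‖t - 0‖ ^ 2 := by
      refine Asymptotics.IsBigO.of_bound 1 (Eventually.of_forall fun x => ?_)
      simp only [sub_zero, norm_pow, Real.norm_eq_abs, one_mul, abs_abs]
      refine pow_le_pow_left₀ (abs_nonneg _) ?_ 2
      rw [abs_of_nonneg (le_max_right x 0)]
      exact max_le (le_abs_self x) (abs_nonneg x)
    simpa using (hO.hasFDerivAt (𝕜 := ℝ) one_lt_two).hasDerivAt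
  · rw [max_eq_left h.le]
    refine (by simpa using hasDerivAt_pow 2 t :
      HasDerivAt (fun t : ℝ => t ^ 2) (2 * t) t).congr_of_eventuallyEq ?_
    filter_upwards [lt_mem_nhds h] with x hx
    simp [max_eq_left hx.le]

theorem hasDerivAt_posPart_cube (t : ℝ) :
    HasDerivAt (fun t : ℝ => max t 0 ^ 3) (3 * max t 0 ^ 2) t := by
  have hmul : ∀ t : ℝ, max t 0 * t = max t 0 ^ 2 := fun t => by
    rcases le_total t 0 with h | h <;> simp [h, sq]
  have h := (hasDerivAt_posPart_sq t).mul (hasDerivAt_id' t)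
  have hfun : (fun t : ℝ => max t 0 ^ 3) = (fun t : ℝ => max t 0 ^ 2) * fun t => t := by
    ext x
    rw [Pi.mul_apply]
    linear_combination (-max x 0) * hmul x
  rw [hfun]
  exact h.congr_deriv (by linear_combination 2 * hmul t)

/-- The truncated paraboloid `(s² - |x - p|²)₊`. -/
def para (p : Plane) (s : ℝ) (x : Plane) : ℝ := max (s ^ 2 - ‖x - p‖ ^ 2) 0

theorem para_nonneg (p : Plane) (s : ℝ) (x : Plane) : 0 ≤ para p s x := le_max_right _ _

theorem para_le (p : Plane) (s : ℝ) (x : Plane) : para p s x ≤ s ^ 2 :=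
  max_le (by nlinarith [sq_nonneg ‖x - p‖]) (sq_nonneg s)

theorem para_eq_zero {p : Plane} {s : ℝ} (hs : 0 ≤ s) {x : Plane} (hx : x ∉ ball p s) :
    para p s x = 0 := by
  rw [mem_ball, dist_eq_norm, not_lt] at hx
  exact max_eq_right (by nlinarith)

theorem continuous_para (p : Plane) (s : ℝ) : Continuous (para p s) := by
  unfold para; fun_prop

theorem hasFDerivAt_sq_sub (p : Plane) (s : ℝ) (x : Plane) :
    HasFDerivAt (fun x => s ^ 2 - ‖x - p‖ ^ 2) ((-2 : ℝ) • innerSL ℝ (x - p) : Plane →L[ℝ] ℝ) x := by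
  have h := ((hasFDerivAt_id x).sub_const p).norm_sq.const_sub (s ^ 2)
  refine h.congr_fderiv ?_
  ext y
  simp

theorem hasFDerivAt_para_cube (p : Plane) (s : ℝ) (x : Plane) :
    HasFDerivAt (fun x => para p s x ^ 3)
      ((3 * para p s x ^ 2) • ((-2 : ℝ) • innerSL ℝ (x - p) : Plane →L[ℝ] ℝ)) x :=
  (hasDerivAt_posPart_cube _).comp_hasFDerivAt x (hasFDerivAt_sq_sub p s x)

theorem fderiv_para_cube (p : Plane) (s : ℝ) (v : Plane) :
    (fun x => fderiv ℝ (fun x => para p s x ^ 3) x v) =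
      fun x => -6 * (para p s x ^ 2 * ⟪x - p, v⟫) := by
  ext x
  rw [(hasFDerivAt_para_cube p s x).fderiv]
  simp only [smul_apply,
    innerSL_apply_apply, smul_eq_mul]
  ring

theorem hasFDerivAt_fderiv_para_cube (p : Plane) (s : ℝ) (v x : Plane) :
    HasFDerivAt (fun x => fderiv ℝ (fun x => para p s x ^ 3) x v)
      ((-6 : ℝ) • (para p s x ^ 2 • innerSL ℝ v +
        ⟪x - p, v⟫ • ((2 * para p s x) • ((-2 : ℝ) • innerSL ℝ (x - p) : Plane →L[ℝ] ℝ)))) x := by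
  rw [fderiv_para_cube]
  have h1 := (hasDerivAt_posPart_sq _).comp_hasFDerivAt x (hasFDerivAt_sq_sub p s x)
  have h2 : HasFDerivAt (fun x : Plane => ⟪x - p, v⟫) (innerSL ℝ v) x := by
    have := ((innerSL ℝ v).hasFDerivAt (x := x - p)).comp x ((hasFDerivAt_id x).sub_const p)
    refine (this.congr_fderiv (ContinuousLinearMap.comp_id _)).congr_of_eventuallyEq ?_
    exact Eventually.of_forall fun y => real_inner_comm _ _
  exact (h1.mul h2).const_smul (-6 : ℝ)

theorem fderiv_fderiv_para_cube (p : Plane) (s : ℝ) (v x : Plane) :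
    fderiv ℝ (fun x => fderiv ℝ (fun x => para p s x ^ 3) x v) x v =
      24 * para p s x * ⟪x - p, v⟫ ^ 2 - 6 * para p s x ^ 2 * ‖v‖ ^ 2 := by
  rw [(hasFDerivAt_fderiv_para_cube p s v x).fderiv]
  simp only [add_apply, smul_apply, innerSL_apply_apply, smul_eq_mul,
    real_inner_self_eq_norm_sq]
  ring

theorem abs_inner_mul_para_le {p : Plane} {s : ℝ} (hs : 0 ≤ s) (v x : Plane) (n : ℕ) :
    para p s x ^ (n + 1) * |⟪x - p, v⟫| ≤ s ^ (2 * (n + 1)) * (s * ‖v‖) := by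
  by_cases hx : x ∈ ball p s
  · rw [mem_ball, dist_eq_norm] at hx
    rw [pow_mul]
    have := para_le p s x
    have := para_nonneg p s x
    gcongr
    exact (abs_real_inner_le_norm _ _).trans (by gcongr)
  · rw [para_eq_zero hs hx, zero_pow (Nat.succ_ne_zero n), zero_mul]; positivity

theorem abs_fderiv_para_cube_le {p : Plane} {s : ℝ} (hs : 0 ≤ s) (v x : Plane) :
    |fderiv ℝ (fun x => para p s x ^ 3) x v| ≤ 6 * (s ^ 4 * (s * ‖v‖)) := by
  rw [congrFun (fderiv_para_cube p s v) x, abs_mul, abs_mul, abs_neg, abs_of_nonneg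
    (pow_nonneg (para_nonneg p s x) 2)]
  have := abs_inner_mul_para_le (p := p) hs v x 1
  norm_num at this ⊢
  linarith

theorem abs_fderiv_fderiv_para_cube_le {p : Plane} {s : ℝ} (hs : 0 ≤ s) (v x : Plane) :
    |fderiv ℝ (fun x => fderiv ℝ (fun x => para p s x ^ 3) x v) x v|
      ≤ 30 * (s ^ 4 * ‖v‖ ^ 2) := by
  rw [fderiv_fderiv_para_cube]
  have h0 := para_nonneg p s x
  have h1 : para p s x * ⟪x - p, v⟫ ^ 2 ≤ s ^ 4 * ‖v‖ ^ 2 := by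
    by_cases hx : x ∈ ball p s
    · rw [mem_ball, dist_eq_norm] at hx
      calc para p s x * ⟪x - p, v⟫ ^ 2 ≤ s ^ 2 * (s * ‖v‖) ^ 2 := by
            rw [← sq_abs ⟪x - p, v⟫]
            gcongr
            · exact para_le p s x
            · exact (abs_real_inner_le_norm _ _).trans (by gcongr)
        _ = s ^ 4 * ‖v‖ ^ 2 := by ring
    · rw [para_eq_zero hs hx, zero_mul]; positivity
  have h2 : para p s x ^ 2 * ‖v‖ ^ 2 ≤ s ^ 4 * ‖v‖ ^ 2 := by
    rw [show s ^ 4 = (s ^ 2) ^ 2 by ring]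
    gcongr
    exact para_le p s x
  have h3 : 0 ≤ para p s x * ⟪x - p, v⟫ ^ 2 := by positivity
  have h4 : 0 ≤ para p s x ^ 2 * ‖v‖ ^ 2 := by positivity
  rw [abs_le]
  constructor <;> nlinarith

theorem integral_fderiv_para_cube_mul_fderiv {f : Plane → ℝ} (hf : Differentiable ℝ f)
    (hfi : Integrable f) {v : Plane} (hf' : Integrable fun x => fderiv ℝ f x v) (p : Plane) {s : ℝ}
    (hs : 0 ≤ s) :
    ∫ x, fderiv ℝ (fun x => para p s x ^ 3) x v * fderiv ℝ f x v =
      - ∫ x, (24 * para p s x * ⟪x - p, v⟫ ^ 2 - 6 * para p s x ^ 2 * ‖v‖ ^ 2) * f x := by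
  simp_rw [← fderiv_fderiv_para_cube]
  have hc : Differentiable ℝ fun x => fderiv ℝ (fun x => para p s x ^ 3) x v :=
    fun x => (hasFDerivAt_fderiv_para_cube p s v x).differentiableAt
  refine integral_mul_fderiv_eq_neg_fderiv_mul_of_integrable ?_ ?_ ?_
    (fun x _ => hc x) (fun x _ => hf x)
  · exact hfi.bdd_mul (measurable_fderiv_apply_const ℝ _ v).aestronglyMeasurable
      (Eventually.of_forall fun x => abs_fderiv_fderiv_para_cube_le hs v x)
  · exact hf'.bdd_mul hc.continuous.aestronglyMeasurable
      (Eventually.of_forall fun x => abs_fderiv_para_cube_le hs v x)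
  · exact hfi.bdd_mul hc.continuous.aestronglyMeasurable
      (Eventually.of_forall fun x => abs_fderiv_para_cube_le hs v x)

end Bump

theorem norm_sq_plane (x : Plane) : ‖x‖ ^ 2 = x 0 ^ 2 + x 1 ^ 2 := by
  rw [EuclideanSpace.real_norm_sq_eq, Fin.sum_univ_two]

section MeanValue

open scoped RealInnerProductSpace

theorem inner_e0 (x : Plane) : ⟪x, e0⟫ = x 0 := by
  simp [e0, EuclideanSpace.inner_single_right]

theorem inner_e1 (x : Plane) : ⟪x, e1⟫ = x 1 := by
  simp [e1, EuclideanSpace.inner_single_right]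

theorem norm_e0 : ‖e0‖ = 1 := by simp [e0]

theorem norm_e1 : ‖e1‖ = 1 := by simp [e1]

theorem integral_grad_para_cube {f : Plane → ℝ} (hf : Differentiable ℝ f)
    (hfi : Integrable f) (hf0 : Integrable (d0R f)) (hf1 : Integrable (d1R f)) (p : Plane) {s : ℝ}
    (hs : 0 ≤ s) :
    ∫ x, (d0R (fun x => para p s x ^ 3) x * d0R f x + d1R (fun x => para p s x ^ 3) x * d1R f x) =
      - ∫ x, (24 * para p s x * ‖x - p‖ ^ 2 - 12 * para p s x ^ 2) * f x := by
  have hint : ∀ v : Plane, Integrable (fun x => fderiv ℝ f x v) →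
      Integrable fun x => fderiv ℝ (fun x => para p s x ^ 3) x v * fderiv ℝ f x v := fun v hv =>
    hv.bdd_mul (measurable_fderiv_apply_const ℝ _ v).aestronglyMeasurable
      (Eventually.of_forall fun x => abs_fderiv_para_cube_le hs v x)
  have hint' : ∀ v : Plane, Integrable fun x =>
      (24 * para p s x * ⟪x - p, v⟫ ^ 2 - 6 * para p s x ^ 2 * ‖v‖ ^ 2) * f x := fun v => by
    simp_rw [← fderiv_fderiv_para_cube]
    exact hfi.bdd_mul (measurable_fderiv_apply_const ℝ _ v).aestronglyMeasurable
      (Eventually.of_forall fun x => abs_fderiv_fderiv_para_cube_le hs v x)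
  unfold d0R d1R at *
  rw [integral_add (hint e0 hf0) (hint e1 hf1), integral_fderiv_para_cube_mul_fderiv hf hfi hf0 p hs,
    integral_fderiv_para_cube_mul_fderiv hf hfi hf1 p hs, ← neg_add,
    ← integral_add (hint' e0) (hint' e1)]
  congr 2
  ext x
  rw [norm_sq_plane (x - p), inner_e0, inner_e1, norm_e0, norm_e1]
  ring

/-- The weighted mean of `f` over the ball of radius `s` around `p`, with a weight that makes its
derivative in `s` a multiple of `∫ f Δ((s² - |x - p|²)₊³)`. -/
def wmean (f : Plane → ℝ) (p : Plane) (s : ℝ) : ℝ := ∫ x, (s ^ 6)⁻¹ * para p s x ^ 2 * f x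

theorem integrable_wmean {f : Plane → ℝ} (hfi : Integrable f) (p : Plane) (s : ℝ) :
    Integrable fun x => (s ^ 6)⁻¹ * para p s x ^ 2 * f x := by
  refine hfi.bdd_mul (c := (s ^ 6)⁻¹ * (s ^ 2) ^ 2) ?_ (Eventually.of_forall fun x => ?_)
  · exact (((continuous_para p s).pow 2).const_mul _).aestronglyMeasurable
  · have h0 := para_nonneg p s x
    have h6 : 0 ≤ s ^ 6 := by positivity
    rw [Real.norm_of_nonneg (by positivity)]
    gcongr
    exact para_le p s x

theorem hasDerivAt_wmean {f : Plane → ℝ} (hfi : Integrable f) (p : Plane) {s : ℝ} (hs : 0 < s) :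
    HasDerivAt (wmean f p)
      ((6 * s ^ 7)⁻¹ * ∫ x, (24 * para p s x * ‖x - p‖ ^ 2 - 12 * para p s x ^ 2) * f x) s := by
  have key := (hasDerivAt_integral_of_dominated_loc_of_deriv_le (μ := volume) (x₀ := s)
    (s := Ioo (s / 2) (2 * s))
    (F := fun s x => (s ^ 6)⁻¹ * para p s x ^ 2 * f x)
    (F' := fun s x => (-6 * (s ^ 7)⁻¹ * para p s x ^ 2 + (s ^ 6)⁻¹ * (2 * para p s x * (2 * s)))
      * f x)
    (bound := fun x => 10 * ((s / 2) ^ 3)⁻¹ * ‖f x‖)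
    (Ioo_mem_nhds (by linarith) (by linarith))
    (Eventually.of_forall fun s => (integrable_wmean hfi p s).aestronglyMeasurable)
    (integrable_wmean hfi p s) ?_ ?_ (hfi.norm.const_mul _) ?_).2
  · refine key.congr_deriv ?_
    rw [← integral_const_mul]
    congr 1
    ext x
    rcases (para_nonneg p s x).eq_or_lt with h0 | h0
    · simp [← h0]
    · have h1 : para p s x = s ^ 2 - ‖x - p‖ ^ 2 := by
        rcases max_choice (s ^ 2 - ‖x - p‖ ^ 2) 0 with h | h
        · exact h
        · exact absurd h h0.ne'
      rw [show ‖x - p‖ ^ 2 = s ^ 2 - para p s x by linarith]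
      field_simp
      ring
  · refine Continuous.aestronglyMeasurable ?_ |>.mul hfi.aestronglyMeasurable
    have := continuous_para p s
    fun_prop
  · refine Eventually.of_forall fun x t ht => ?_
    have ht0 : 0 < t := (half_pos hs).trans ht.1
    have h0 := para_nonneg p t x
    have h1 := para_le p t x
    rw [norm_mul, Real.norm_eq_abs]
    gcongr
    calc |-6 * (t ^ 7)⁻¹ * para p t x ^ 2 + (t ^ 6)⁻¹ * (2 * para p t x * (2 * t))|
        ≤ 6 * (t ^ 7)⁻¹ * para p t x ^ 2 + (t ^ 6)⁻¹ * (2 * para p t x * (2 * t)) := by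
          have a1 : 0 ≤ (t ^ 7)⁻¹ * para p t x ^ 2 := by positivity
          have a2 : 0 ≤ (t ^ 6)⁻¹ * (2 * para p t x * (2 * t)) := by positivity
          rw [abs_le]
          constructor <;> linarith
      _ ≤ 6 * (t ^ 7)⁻¹ * (t ^ 2) ^ 2 + (t ^ 6)⁻¹ * (2 * t ^ 2 * (2 * t)) := by gcongr
      _ = 10 * (t ^ 3)⁻¹ := by field_simp; ring
      _ ≤ 10 * ((s / 2) ^ 3)⁻¹ := by
          have := ht.1.le
          gcongr
  · refine Eventually.of_forall fun x t ht => ?_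
    have ht0 : t ≠ 0 := ((half_pos hs).trans ht.1).ne'
    have h1 : HasDerivAt (fun t => (t ^ 6)⁻¹) (-6 * (t ^ 7)⁻¹) t := by
      refine ((hasDerivAt_pow 6 t).fun_inv (pow_ne_zero 6 ht0)).congr_deriv ?_
      field_simp
      push_cast
      ring
    have h2 : HasDerivAt (fun t => para p t x ^ 2) (2 * para p t x * (2 * t)) t :=
      (hasDerivAt_posPart_sq _).comp t
        (by simpa using (hasDerivAt_pow 2 t).sub_const (‖x - p‖ ^ 2))
    exact (h1.mul h2).mul_const (f x)

theorem volume_real_ball (p : Plane) {r : ℝ} (hr : 0 ≤ r) :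
    volume.real (ball p r) = Real.pi * r ^ 2 := by
  rw [Measure.real, EuclideanSpace.volume_ball_fin_two, ENNReal.toReal_mul, ENNReal.toReal_pow,
    ENNReal.toReal_ofReal hr]
  simp [mul_comm, Real.pi_nonneg]

theorem wmean_le {f : Plane → ℝ} (hfi : Integrable f) (hf0 : ∀ x, 0 ≤ f x) (p : Plane) {r : ℝ}
    (hr : 0 < r) : wmean f p r ≤ (r ^ 2)⁻¹ * ∫ x in ball p r, f x := by
  rw [← integral_const_mul, ← integral_indicator measurableSet_ball]
  refine integral_mono (integrable_wmean hfi p r)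
    ((hfi.const_mul _).indicator measurableSet_ball) fun x => ?_
  by_cases hx : x ∈ ball p r
  · rw [indicator_of_mem hx]
    have h0 := para_nonneg p r x
    refine mul_le_mul_of_nonneg_right ?_ (hf0 x)
    calc (r ^ 6)⁻¹ * para p r x ^ 2 ≤ (r ^ 6)⁻¹ * (r ^ 2) ^ 2 := by
          gcongr; exact para_le p r x
      _ = (r ^ 2)⁻¹ := by field_simp
  · rw [indicator_of_notMem hx]
    simp [para_eq_zero hr.le hx]

theorem le_wmean {f : Plane → ℝ} (hfi : Integrable f) (hf0 : ∀ x, 0 ≤ f x) {p : Plane} {s b : ℝ}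
    (hs : 0 < s) (hb : ∀ x ∈ ball p (s / 2), b ≤ f x) :
    9 * Real.pi / 64 * b ≤ wmean f p s := by
  have h1 : ∫ x in ball p (s / 2), 9 / 16 * (s ^ 2)⁻¹ * b = 9 * Real.pi / 64 * b := by
    rw [setIntegral_const, volume_real_ball p (by positivity), smul_eq_mul]
    field_simp
    ring
  rw [← h1, ← integral_indicator measurableSet_ball]
  refine integral_mono ?_ (integrable_wmean hfi p s) fun x => ?_
  · refine IntegrableOn.integrable_indicator ?_ measurableSet_ball
    exact integrableOn_const measure_ball_lt_top.ne
  by_cases hx : x ∈ ball p (s / 2)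
  · rw [indicator_of_mem hx]
    have hx' := hx
    rw [mem_ball, dist_eq_norm] at hx'
    have h2 : 3 / 4 * s ^ 2 ≤ para p s x := le_max_of_le_left (by nlinarith [norm_nonneg (x - p)])
    calc 9 / 16 * (s ^ 2)⁻¹ * b ≤ 9 / 16 * (s ^ 2)⁻¹ * f x := by gcongr; exact hb x hx
      _ = (s ^ 6)⁻¹ * (3 / 4 * s ^ 2) ^ 2 * f x := by field_simp; ring
      _ ≤ (s ^ 6)⁻¹ * para p s x ^ 2 * f x := by
          have := hf0 x
          gcongr
  · rw [indicator_of_notMem hx]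
    have := hf0 x
    positivity

/-- A local mean value inequality for functions that are almost subharmonic when tested against
the functions `(s² - |x - p|²)₊³`. -/
theorem mean_value_inequality {f : Plane → ℝ} (hf : Differentiable ℝ f) (hfi : Integrable f)
    (hf0 : Integrable (d0R f)) (hf1 : Integrable (d1R f)) (hpos : ∀ x, 0 ≤ f x) {p : Plane}
    {K r : ℝ} (hK0 : 0 ≤ K) (hr : 0 < r)
    (hK : ∀ s ∈ Ioc 0 r, ∫ x, (d0R (fun x => para p s x ^ 3) x * d0R f x +
      d1R (fun x => para p s x ^ 3) x * d1R f x) ≤ K * s ^ 8) :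
    9 * Real.pi / 128 * f p ≤ (r ^ 2)⁻¹ * (∫ x in ball p r, f x) + K * r ^ 2 / 12 := by
  rcases (hpos p).eq_or_lt with hp | hp
  · have : 0 ≤ ∫ x in ball p r, f x := integral_nonneg hpos
    rw [← hp, mul_zero]
    positivity
  have hmono : MonotoneOn (fun s => wmean f p s + K * s ^ 2 / 12) (Ioc 0 r) := by
    have hd : ∀ s : ℝ, 0 < s → HasDerivAt (fun s => wmean f p s + K * s ^ 2 / 12)
        ((6 * s ^ 7)⁻¹ * (∫ x, (24 * para p s x * ‖x - p‖ ^ 2 - 12 * para p s x ^ 2) * f x)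
          + K * (2 * s) / 12) s := fun s hs =>
      (hasDerivAt_wmean hfi p hs).add
        (((by simpa using hasDerivAt_pow 2 s : HasDerivAt (fun s : ℝ => s ^ 2) (2 * s) s).const_mul
          K).div_const 12)
    refine monotoneOn_of_deriv_nonneg (convex_Ioc 0 r)
      (fun s hs => (hd s hs.1).continuousAt.continuousWithinAt)
      (fun s hs => ?_) fun s hs => ?_
    · rw [interior_Ioc] at hs
      exact (hd s hs.1).differentiableAt.differentiableWithinAt
    · rw [interior_Ioc] at hs
      rw [(hd s hs.1).deriv]
      have h := hK s ⟨hs.1, hs.2.le⟩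
      rw [integral_grad_para_cube hf hfi hf0 hf1 p hs.1.le] at h
      have hs0 := hs.1
      calc (0 : ℝ) = (6 * s ^ 7)⁻¹ * -(K * s ^ 8) + K * (2 * s) / 12 := by field_simp; ring
        _ ≤ _ := by gcongr; linarith
  obtain ⟨δ, hδ, hball⟩ := Metric.eventually_nhds_iff_ball.1
    (hf.continuous.continuousAt.eventually (lt_mem_nhds (half_lt_self hp)))
  have hs0 : 0 < min δ r := lt_min hδ hr
  have h1 := le_wmean hfi hpos (p := p) hs0 (b := f p / 2) fun x hx =>
    (hball x (ball_subset_ball ((half_le_self hs0.le).trans (min_le_left _ _)) hx)).le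
  have h2 := hmono ⟨hs0, min_le_right _ _⟩ ⟨hr, le_rfl⟩ (min_le_right δ r)
  have h3 := wmean_le hfi hpos p hr
  simp only at h2
  have h4 : 0 ≤ K * min δ r ^ 2 / 12 := by positivity
  linarith

end MeanValue

/-- The negative part of `log |z|`. -/
def logNeg (z : Plane) : ℝ := max (-Real.log ‖z‖) 0

theorem logNeg_nonneg (z : Plane) : 0 ≤ logNeg z := le_max_right _ _

theorem neg_logNeg_le (z : Plane) : -logNeg z ≤ Real.log ‖z‖ :=
  neg_le.1 (le_max_left _ _)

theorem abs_log_norm_le (z : Plane) : |Real.log ‖z‖| ≤ logNeg z + ‖z‖ := by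
  have h1 := neg_logNeg_le z
  have h2 := logNeg_nonneg z
  have h3 := Real.log_le_self (norm_nonneg z)
  have h4 := norm_nonneg z
  rw [abs_le]
  constructor <;> linarith

theorem integrable_logNeg : Integrable logNeg := by
  refine (integrable_fun_norm_addHaar volume (f := fun t : ℝ => max (-Real.log t) 0)).2 ?_
  have hd : Module.finrank ℝ Plane - 1 = 1 := by simp
  rw [hd]
  have hb : IntegrableOn (indicator (Ioc (0 : ℝ) 1) fun _ => (1 : ℝ)) (Ioi 0) := by
    refine Integrable.integrableOn (IntegrableOn.integrable_indicator ?_ measurableSet_Ioc)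
    exact integrableOn_const (by simp)
  refine Integrable.mono' hb ?_ ?_
  · exact Measurable.aestronglyMeasurable (by fun_prop)
  · refine (ae_restrict_iff' measurableSet_Ioi).2 (Eventually.of_forall fun t ht => ?_)
    have ht : 0 < t := ht
    rw [pow_one, smul_eq_mul, Real.norm_of_nonneg (mul_nonneg ht.le (le_max_right _ _))]
    rcases le_or_gt t 1 with h | h
    · rw [indicator_of_mem (show t ∈ Ioc (0 : ℝ) 1 from ⟨ht, h⟩)]
      have h1 := Real.log_le_sub_one_of_pos (inv_pos.2 ht)
      rw [Real.log_inv] at h1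
      have h2 : max (-Real.log t) 0 ≤ t⁻¹ :=
        max_le (by linarith) (inv_pos.2 ht).le
      calc t * max (-Real.log t) 0 ≤ t * t⁻¹ := by gcongr
        _ = 1 := mul_inv_cancel₀ ht.ne'
    · rw [indicator_of_notMem (fun h' => absurd h'.2 (not_le.2 h)),
        max_eq_right (by simpa using Real.log_nonneg h.le), mul_zero]

/-- Bounded integrable densities with finite first moment. -/
structure Density (g : Plane → ℝ) : Prop where
  integrable : Integrable g
  moment : Integrable fun x => ‖x‖ * g x
  bdd : ∃ M, ∀ x, |g x| ≤ M

theorem Density.bdd_mul {g h : Plane → ℝ} (hg : Density g) (hh : Continuous h) {C : ℝ}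
    (hC : ∀ x, |h x| ≤ C) : Density fun x => h x * g x where
  integrable := hg.integrable.bdd_mul hh.aestronglyMeasurable (Eventually.of_forall hC)
  moment := by
    refine (hg.moment.bdd_mul hh.aestronglyMeasurable (Eventually.of_forall hC)).congr ?_
    exact Eventually.of_forall fun x => by ring
  bdd := by
    obtain ⟨M, hM⟩ := hg.bdd
    refine ⟨C * M, fun x => ?_⟩
    rw [abs_mul]
    exact mul_le_mul (hC x) (hM x) (abs_nonneg _) ((abs_nonneg _).trans (hC x))

/-- The logarithmic interaction of two densities. -/
def logInt (g h : Plane → ℝ) : ℝ :=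
  ∫ p : Plane × Plane, Real.log ‖p.1 - p.2‖ * g p.1 * h p.2

theorem integrable_logInt {g h : Plane → ℝ} (hg : Density g) (hh : Density h) :
    Integrable fun p : Plane × Plane => Real.log ‖p.1 - p.2‖ * g p.1 * h p.2 := by
  obtain ⟨M, hM⟩ := hh.bdd
  have h1 : Integrable fun p : Plane × Plane => |g p.1| * logNeg (p.2 - p.1) :=
    (hg.integrable.abs.convolution_integrand (ContinuousLinearMap.mul ℝ ℝ) integrable_logNeg).swap
  have h2 := hg.moment.abs.mul_prod hh.integrable.abs
  have h3 := hg.integrable.abs.mul_prod hh.moment.abs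
  refine Integrable.mono' ((h1.const_mul M).add (h2.add h3)) ?_ ?_
  · refine (AEStronglyMeasurable.mul ?_ hg.integrable.aestronglyMeasurable.comp_fst).mul
      hh.integrable.aestronglyMeasurable.comp_snd
    exact Measurable.aestronglyMeasurable (by fun_prop)
  · refine Eventually.of_forall fun p => ?_
    simp only [Pi.add_apply, Real.norm_eq_abs, abs_mul, abs_norm]
    have a1 := abs_log_norm_le (p.1 - p.2)
    have a2 := norm_sub_le p.1 p.2
    have a3 : logNeg (p.1 - p.2) = logNeg (p.2 - p.1) := by rw [logNeg, logNeg, norm_sub_rev]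
    have a4 := logNeg_nonneg (p.2 - p.1)
    calc |Real.log ‖p.1 - p.2‖| * |g p.1| * |h p.2|
        ≤ (logNeg (p.2 - p.1) + (‖p.1‖ + ‖p.2‖)) * |g p.1| * |h p.2| := by
          gcongr; linarith
      _ = |h p.2| * (|g p.1| * logNeg (p.2 - p.1)) +
          (‖p.1‖ * |g p.1| * |h p.2| + |g p.1| * (‖p.2‖ * |h p.2|)) := by ring
      _ ≤ _ := by gcongr; exact hM p.2

theorem logInt_eq_iterated {g h : Plane → ℝ} (hg : Density g) (hh : Density h) :
    logInt g h = ∫ x, ∫ y, Real.log ‖x - y‖ * g x * h y :=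
  integral_prod _ (integrable_logInt hg hh)

theorem logInt_comm (g h : Plane → ℝ) : logInt g h = logInt h g := by
  unfold logInt
  rw [Measure.volume_eq_prod, ← integral_prod_swap]
  congr 1
  ext p
  rw [Prod.fst_swap, Prod.snd_swap, norm_sub_rev]
  ring

theorem logInt_perturb {f k : Plane → ℝ} (hf : Density f) (hk : Density k) (t : ℝ) :
    ∫ x, ∫ y, Real.log ‖x - y‖ * (f x + t * k x) * (f y + t * k y) =
      logInt f f + 2 * t * logInt k f + t ^ 2 * logInt k k := by
  have i1 := integrable_logInt hf hf
  have i2 := (integrable_logInt hf hk).const_mul t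
  have i3 := (integrable_logInt hk hf).const_mul t
  have i4 := (integrable_logInt hk hk).const_mul (t ^ 2)
  have hsum : (fun p : Plane × Plane =>
      Real.log ‖p.1 - p.2‖ * (f p.1 + t * k p.1) * (f p.2 + t * k p.2)) = fun p =>
      (Real.log ‖p.1 - p.2‖ * f p.1 * f p.2 + t * (Real.log ‖p.1 - p.2‖ * f p.1 * k p.2)) +
      (t * (Real.log ‖p.1 - p.2‖ * k p.1 * f p.2) +
        t ^ 2 * (Real.log ‖p.1 - p.2‖ * k p.1 * k p.2)) := by
    ext p; ring
  have hint : Integrable (fun p : Plane × Plane =>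
      Real.log ‖p.1 - p.2‖ * (f p.1 + t * k p.1) * (f p.2 + t * k p.2)) := by
    rw [hsum]
    exact (i1.add i2).add (i3.add i4)
  have h := integral_prod _ hint
  simp only at h
  rw [← h, ← Measure.volume_eq_prod, hsum]
  refine (integral_add (i1.add i2) (i3.add i4)).trans ?_
  rw [integral_add' i1 i2, integral_add' i3 i4, integral_const_mul, integral_const_mul,
    integral_const_mul]
  change logInt f f + t * logInt f k + (t * logInt k f + t ^ 2 * logInt k k) = _
  rw [logInt_comm f k]
  ring

theorem integrable_logInt_right {f : Plane → ℝ} (hf : Density f) (x : Plane) :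
    Integrable fun y => Real.log ‖x - y‖ * f y := by
  obtain ⟨M, hM⟩ := hf.bdd
  refine Integrable.mono' (((integrable_logNeg.comp_sub_left x).const_mul M).add
    ((hf.integrable.abs.const_mul ‖x‖).add hf.moment.abs)) ?_ (Eventually.of_forall fun y => ?_)
  · refine AEStronglyMeasurable.mul ?_ hf.integrable.aestronglyMeasurable
    exact Measurable.aestronglyMeasurable (by fun_prop)
  · simp only [Pi.add_apply, Real.norm_eq_abs, abs_mul, abs_norm]
    have a1 := abs_log_norm_le (x - y)
    have a2 := norm_sub_le x y
    have a4 := logNeg_nonneg (x - y)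
    calc |Real.log ‖x - y‖| * |f y| ≤ (logNeg (x - y) + (‖x‖ + ‖y‖)) * |f y| := by
          gcongr; linarith
      _ = |f y| * logNeg (x - y) + (‖x‖ * |f y| + ‖y‖ * |f y|) := by ring
      _ ≤ _ := by gcongr; exact hM y

theorem le_logInt {f g : Plane → ℝ} (hf : Density f) (hg : Density g) (hf0 : ∀ x, 0 ≤ f x)
    (hg0 : ∀ x, 0 ≤ g x) {m : ℝ} (hm : ∀ x, f x ≤ m) :
    -((∫ z, logNeg z) * m * ∫ x, g x) ≤ logInt g f := by
  rw [logInt_eq_iterated hg hf, ← integral_const_mul, ← integral_neg]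
  refine integral_mono (hg.integrable.const_mul _).neg
    (integrable_logInt hg hf).integral_prod_left fun x => ?_
  have h1 : -((∫ z, logNeg z) * m) ≤ ∫ y, Real.log ‖x - y‖ * f y := by
    rw [← integral_sub_left_eq_self logNeg volume x, ← integral_mul_const, ← integral_neg]
    refine integral_mono ((integrable_logNeg.comp_sub_left x).mul_const m).neg
      (integrable_logInt_right hf x) fun y => ?_
    have a1 := neg_logNeg_le (x - y)
    have a2 := logNeg_nonneg (x - y)
    calc -(logNeg (x - y) * m) ≤ -(logNeg (x - y) * f y) := by gcongr; exact hm y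
      _ = -logNeg (x - y) * f y := by ring
      _ ≤ Real.log ‖x - y‖ * f y := mul_le_mul_of_nonneg_right a1 (hf0 y)
  calc -((∫ z, logNeg z) * m * g x) = g x * -((∫ z, logNeg z) * m) := by ring
    _ ≤ g x * ∫ y, Real.log ‖x - y‖ * f y := mul_le_mul_of_nonneg_left h1 (hg0 x)
    _ = ∫ y, Real.log ‖x - y‖ * g x * f y := by
        rw [← integral_const_mul]
        congr 1
        ext y
        ring

section Pointwise

open scoped RealInnerProductSpace ComplexConjugate

theorem fderiv_normSq {u : Plane → ℂ} {x : Plane} (hu : DifferentiableAt ℝ u x) (v : Plane) :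
    fderiv ℝ (fun x => ‖u x‖ ^ 2) x v = 2 * (conj (u x) * fderiv ℝ u x v).re := by
  rw [hu.hasFDerivAt.norm_sq.fderiv]
  simp [Complex.inner]
  ring

theorem differentiable_normSq {u : Plane → ℂ} (hu : Differentiable ℝ u) :
    Differentiable ℝ fun x => ‖u x‖ ^ 2 := fun x => (hu x).hasFDerivAt.norm_sq.differentiableAt

theorem abs_fderiv_normSq_le {u : Plane → ℂ} {x : Plane} (hu : DifferentiableAt ℝ u x)
    (v : Plane) : |fderiv ℝ (fun x => ‖u x‖ ^ 2) x v| ≤ ‖u x‖ ^ 2 + ‖fderiv ℝ u x v‖ ^ 2 := by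
  rw [fderiv_normSq hu, abs_mul, abs_two]
  have h := Complex.abs_re_le_norm (conj (u x) * fderiv ℝ u x v)
  rw [norm_mul, RCLike.norm_conj] at h
  nlinarith [sq_nonneg (‖u x‖ - ‖fderiv ℝ u x v‖)]

theorem norm_sq_le_of_plane (L : Plane →L[ℝ] ℝ) : ‖L‖ ^ 2 ≤ L e0 ^ 2 + L e1 ^ 2 := by
  have h : ‖L‖ ≤ √(L e0 ^ 2 + L e1 ^ 2) := by
    refine L.opNorm_le_bound (Real.sqrt_nonneg _) fun x => ?_
    have hx : x = x 0 • e0 + x 1 • e1 := by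
      ext i
      fin_cases i <;> simp [e0, e1]
    have hL : L x = x 0 * L e0 + x 1 * L e1 := by
      conv_lhs => rw [hx]
      rw [map_add, map_smul, map_smul, smul_eq_mul, smul_eq_mul]
    rw [← Real.sqrt_sq (norm_nonneg x), ← Real.sqrt_mul (by positivity), norm_sq_plane, hL]
    refine Real.abs_le_sqrt ?_
    nlinarith [sq_nonneg (x 0 * L e1 - x 1 * L e0)]
  calc ‖L‖ ^ 2 ≤ √(L e0 ^ 2 + L e1 ^ 2) ^ 2 := by gcongr
    _ = _ := Real.sq_sqrt (by positivity)

theorem fderiv_norm_mul {u : Plane → ℂ} {x : Plane} (hu : DifferentiableAt ℝ u x)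
    (hx : u x ≠ 0) (v : Plane) :
    ‖u x‖ * fderiv ℝ (fun x => ‖u x‖) x v = (conj (u x) * fderiv ℝ u x v).re := by
  have h1 : DifferentiableAt ℝ (fun x => ‖u x‖) x := hu.norm ℝ hx
  have h2 := (h1.hasFDerivAt.pow 2).fderiv
  have h3 := fderiv_normSq hu v
  have h4 : 2 • ‖u x‖ ^ (2 - 1) = 2 * ‖u x‖ := by simp
  rw [h2, h4, smul_apply, smul_eq_mul] at h3
  linarith

/-- The diamagnetic inequality for the magnetic potential `(Ω/2) x^⊥`. -/
theorem gradAbsSq_le {u : Plane → ℂ} {x : Plane} (hu : DifferentiableAt ℝ u x) (Ω : ℝ) :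
    gradAbsSq u x ≤ gradSq u x - Ω * momentum u x + Ω ^ 2 / 4 * ‖x‖ ^ 2 * ‖u x‖ ^ 2 := by
  have hre : ∀ (z w : ℂ) (b : ℝ), (conj z * w).re ^ 2 ≤
      ‖z‖ ^ 2 * (‖w‖ ^ 2 - 2 * b * (conj z * w).im + b ^ 2 * ‖z‖ ^ 2) := fun z w b => by
    rw [← Complex.normSq_eq_norm_sq, ← Complex.normSq_eq_norm_sq, Complex.normSq_apply,
      Complex.normSq_apply]
    simp only [Complex.mul_re, Complex.mul_im, Complex.conj_re, Complex.conj_im]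
    nlinarith [sq_nonneg ((z.re * w.im - z.im * w.re) - b * (z.re * z.re + z.im * z.im))]
  have h0 := hre (u x) (d0 u x) (Ω / 2 * (-(x 1)))
  have h1 := hre (u x) (d1 u x) (Ω / 2 * x 0)
  rcases eq_or_ne (u x) 0 with hx | hx
  · have hmin : IsLocalMin (fun y => ‖u y‖) x :=
      Eventually.of_forall fun y => by simp [hx]
    rw [gradAbsSq, hmin.fderiv_eq_zero]
    simp only [gradSq, momentum, hx, norm_zero, map_zero, zero_mul, Complex.zero_im, mul_zero,
      add_zero, sub_zero, ne_eq, OfNat.ofNat_ne_zero, not_false_eq_true, zero_pow]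
    positivity
  · have hpos : 0 < ‖u x‖ ^ 2 := by positivity
    rw [d0, ← fderiv_norm_mul hu hx e0, mul_pow] at h0
    rw [d1, ← fderiv_norm_mul hu hx e1, mul_pow] at h1
    replace h0 := le_of_mul_le_mul_left h0 hpos
    replace h1 := le_of_mul_le_mul_left h1 hpos
    refine (norm_sq_le_of_plane _).trans ((add_le_add h0 h1).trans_eq ?_)
    rw [gradSq, momentum, norm_sq_plane x, d0, d1]
    ring

theorem abs_momentum_le (u : Plane → ℂ) (x : Plane) :
    |momentum u x| ≤ ‖x‖ ^ 2 * ‖u x‖ ^ 2 + gradSq u x := by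
  have h0 := Complex.abs_im_le_norm (conj (u x) * d0 u x)
  have h1 := Complex.abs_im_le_norm (conj (u x) * d1 u x)
  rw [norm_mul, RCLike.norm_conj] at h0 h1
  have a0 : |-(x 1) * (conj (u x) * d0 u x).im| ≤ |x 1| * (‖u x‖ * ‖d0 u x‖) := by
    rw [abs_mul, abs_neg]; gcongr
  have a1 : |x 0 * (conj (u x) * d1 u x).im| ≤ |x 0| * (‖u x‖ * ‖d1 u x‖) := by
    rw [abs_mul]; gcongr
  refine (abs_add_le _ _).trans ((add_le_add a0 a1).trans ?_)
  rw [norm_sq_plane x, gradSq, ← sq_abs (x 0), ← sq_abs (x 1)]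
  nlinarith [sq_nonneg (|x 1| * ‖u x‖ - ‖d0 u x‖), sq_nonneg (|x 0| * ‖u x‖ - ‖d1 u x‖),
    sq_nonneg (|x 1| * ‖u x‖), sq_nonneg (|x 0| * ‖u x‖), sq_nonneg ‖d0 u x‖,
    sq_nonneg ‖d1 u x‖]

theorem fderiv_ofReal_mul {u : Plane → ℂ} {ρ : Plane → ℝ} {x : Plane}
    (hu : DifferentiableAt ℝ u x) (hρ : DifferentiableAt ℝ ρ x) (v : Plane) :
    fderiv ℝ (fun x => (ρ x : ℂ) * u x) x v = ρ x * fderiv ℝ u x v + fderiv ℝ ρ x v * u x := by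
  have h := ((Complex.ofRealCLM.hasFDerivAt.comp x hρ.hasFDerivAt).mul hu.hasFDerivAt).fderiv
  refine (congrArg (fun L : Plane →L[ℝ] ℂ => L v) h).trans ?_
  simp
  ring

theorem momentum_ofReal_mul {u : Plane → ℂ} {ρ : Plane → ℝ} {x : Plane}
    (hu : DifferentiableAt ℝ u x) (hρ : DifferentiableAt ℝ ρ x) :
    momentum (fun x => (ρ x : ℂ) * u x) x = ρ x ^ 2 * momentum u x := by
  simp only [momentum, d0, d1, fderiv_ofReal_mul hu hρ, map_mul, Complex.conj_ofReal,
    Complex.mul_im, Complex.mul_re, Complex.add_re, Complex.add_im, Complex.ofReal_re,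
    Complex.ofReal_im, Complex.conj_re, Complex.conj_im]
  ring

theorem gradSq_ofReal_mul {u : Plane → ℂ} {ρ : Plane → ℝ} {x : Plane}
    (hu : DifferentiableAt ℝ u x) (hρ : DifferentiableAt ℝ ρ x) :
    gradSq (fun x => (ρ x : ℂ) * u x) x = ρ x ^ 2 * gradSq u x +
      ρ x * (d0R ρ x * d0R (fun x => ‖u x‖ ^ 2) x + d1R ρ x * d1R (fun x => ‖u x‖ ^ 2) x) +
      gradSqR ρ x * ‖u x‖ ^ 2 := by
  simp only [gradSq, gradSqR, d0R, d1R, d0, d1, fderiv_ofReal_mul hu hρ, fderiv_normSq hu]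
  simp only [← Complex.normSq_eq_norm_sq, Complex.normSq_apply,
    Complex.mul_im, Complex.mul_re, Complex.add_re, Complex.add_im, Complex.ofReal_re,
    Complex.ofReal_im, Complex.conj_re, Complex.conj_im]
  ring

theorem norm_ofReal_mul_sq (u : Plane → ℂ) (ρ : Plane → ℝ) (x : Plane) :
    ‖(ρ x : ℂ) * u x‖ ^ 2 = ρ x ^ 2 * ‖u x‖ ^ 2 := by
  rw [norm_mul, mul_pow, Complex.norm_real, Real.norm_eq_abs, sq_abs]

end Pointwise

section Integrability

variable {V : Plane → ℝ} {u : Plane → ℂ}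

theorem InH.integrable_norm_sq_mul (hu : InH V u) (hV : V110 V) :
    Integrable fun x => ‖x‖ ^ 2 * ‖u x‖ ^ 2 := by
  obtain ⟨-, hV0, -, c, hc, R, hR⟩ := hV
  refine Integrable.mono' ((hu.1.2.1.const_mul (R ^ 2)).add (hu.2.const_mul c⁻¹)) ?_
    (Eventually.of_forall fun x => ?_)
  · have := hu.1.1.continuous
    exact Continuous.aestronglyMeasurable (by fun_prop)
  · rw [Real.norm_of_nonneg (by positivity), Pi.add_apply, ← mul_assoc, ← add_mul]
    have h0 := hV0 x
    gcongr
    rcases le_or_gt R ‖x‖ with h | h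
    · have := hR x h
      calc ‖x‖ ^ 2 = c⁻¹ * (c * ‖x‖ ^ 2) := by field_simp
        _ ≤ c⁻¹ * V x := by gcongr
        _ ≤ R ^ 2 + c⁻¹ * V x := by nlinarith [sq_nonneg R]
    · have : ‖x‖ ^ 2 ≤ R ^ 2 := by gcongr
      have : 0 ≤ c⁻¹ * V x := by positivity
      linarith

theorem InH.density (hu : InH V u) (hV : V110 V) {m : ℝ} (hm : ∀ x, ‖u x‖ ^ 2 ≤ m) :
    Density fun x => ‖u x‖ ^ 2 where
  integrable := hu.1.2.1
  moment := by
    refine Integrable.mono' (hu.1.2.1.add (hu.integrable_norm_sq_mul hV)) ?_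
      (Eventually.of_forall fun x => ?_)
    · have := hu.1.1.continuous
      exact Continuous.aestronglyMeasurable (by fun_prop)
    · rw [Real.norm_of_nonneg (by positivity), Pi.add_apply]
      have : 0 ≤ ‖u x‖ ^ 2 := by positivity
      nlinarith [sq_nonneg (‖x‖ - 1)]
  bdd := ⟨m, fun x => by rw [abs_of_nonneg (by positivity)]; exact hm x⟩

theorem measurable_momentum (hu : Differentiable ℝ u) : Measurable (momentum u) := by
  have h0 : Measurable (d0 u) := measurable_fderiv_apply_const ℝ u e0
  have h1 : Measurable (d1 u) := measurable_fderiv_apply_const ℝ u e1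
  have := hu.continuous.measurable
  unfold momentum
  have := Complex.continuous_conj.measurable.comp this
  refine ((Measurable.neg (by fun_prop)).mul (Complex.measurable_im.comp ?_)).add
    (Measurable.mul (by fun_prop) (Complex.measurable_im.comp ?_))
  · exact this.mul h0
  · exact this.mul h1

theorem InH.integrable_momentum (hu : InH V u) (hV : V110 V) : Integrable (momentum u) :=
  Integrable.mono' ((hu.integrable_norm_sq_mul hV).add hu.1.2.2)
    (measurable_momentum hu.1.1).aestronglyMeasurable
    (Eventually.of_forall fun x => abs_momentum_le u x)

theorem InH1.integrable_fderiv_normSq (hu : InH1 u) {v : Plane}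
    (hv : ∀ x, ‖fderiv ℝ u x v‖ ^ 2 ≤ gradSq u x) :
    Integrable fun x => fderiv ℝ (fun x => ‖u x‖ ^ 2) x v :=
  Integrable.mono' (hu.2.1.add hu.2.2) (measurable_fderiv_apply_const ℝ _ v).aestronglyMeasurable
    (Eventually.of_forall fun x =>
      (abs_fderiv_normSq_le (hu.1 x) v).trans (add_le_add_right (hv x) _))

theorem InH1.integrable_d0R (hu : InH1 u) : Integrable (d0R fun x => ‖u x‖ ^ 2) :=
  hu.integrable_fderiv_normSq fun _ => le_add_of_nonneg_right (sq_nonneg _)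

theorem InH1.integrable_d1R (hu : InH1 u) : Integrable (d1R fun x => ‖u x‖ ^ 2) :=
  hu.integrable_fderiv_normSq fun _ => le_add_of_nonneg_left (sq_nonneg _)

theorem InH1.integrable_gradAbsSq (hu : InH1 u) : Integrable (gradAbsSq u) := by
  refine Integrable.mono' hu.2.2 ?_ (Eventually.of_forall fun x => ?_)
  · exact ((measurable_fderiv ℝ _).norm.pow_const 2).aestronglyMeasurable
  · rw [gradAbsSq, Real.norm_of_nonneg (by positivity)]
    simpa [gradAbsSq] using gradAbsSq_le (hu.1 x) 0

theorem integrable_norm_pow_four (hu : Integrable fun x => ‖u x‖ ^ 2) {m : ℝ}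
    (hm : ∀ x, ‖u x‖ ^ 2 ≤ m) : Integrable fun x => ‖u x‖ ^ 4 := by
  refine (hu.bdd_mul hu.aestronglyMeasurable (c := m) (Eventually.of_forall fun x => ?_)).congr
    (Eventually.of_forall fun x => by ring)
  rw [Real.norm_of_nonneg (by positivity)]
  exact hm x

end Integrability

/-- The quadratic part of the energy density. -/
def kin (V : Plane → ℝ) (Ω : ℝ) (u : Plane → ℂ) (x : Plane) : ℝ :=
  gradSq u x + V x * ‖u x‖ ^ 2 - Ω * momentum u x

/-- The density `∇h · ∇|u|²`. -/
def crossGrad (h : Plane → ℝ) (u : Plane → ℂ) (x : Plane) : ℝ :=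
  d0R h x * d0R (fun x => ‖u x‖ ^ 2) x + d1R h x * d1R (fun x => ‖u x‖ ^ 2) x

section FirstVariation

variable {V : Plane → ℝ} {u : Plane → ℂ} {Ω m : ℝ}

theorem InH.integrable_kin (hu : InH V u) (hV : V110 V) : Integrable (kin V Ω u) :=
  (hu.1.2.2.add hu.2).sub ((hu.integrable_momentum hV).const_mul Ω)

theorem Ea_eq (hu : InH V u) (hV : V110 V) :
    Ea V Ω u = (∫ x, kin V Ω u x) + 1 / 2 * logConv u - 1 / 2 * ∫ x, ‖u x‖ ^ 4 := by
  have h : ∫ x, kin V Ω u x =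
      (∫ x, (gradSq u x + V x * ‖u x‖ ^ 2)) - Ω * ∫ x, momentum u x := by
    rw [← integral_const_mul]
    exact integral_sub (hu.1.2.2.add hu.2) ((hu.integrable_momentum hV).const_mul Ω)
  rw [Ea, h]
  ring

theorem gradSq_nonneg (u : Plane → ℂ) (x : Plane) : 0 ≤ gradSq u x := by
  unfold gradSq; positivity

theorem measurable_gradSq (u : Plane → ℂ) : Measurable (gradSq u) :=
  ((measurable_fderiv_apply_const ℝ u e0).norm.pow_const 2).add
    ((measurable_fderiv_apply_const ℝ u e1).norm.pow_const 2)

theorem InH1.integrable_crossGrad (hu : InH1 u) {h : Plane → ℝ} {M : ℝ}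
    (hM : ∀ x, gradSqR h x ≤ M) : Integrable (crossGrad h u) := by
  refine (hu.integrable_d0R.bdd_mul (c := √M) ?_ ?_).add
    (hu.integrable_d1R.bdd_mul (c := √M) ?_ ?_)
  · exact (measurable_fderiv_apply_const ℝ h e0).aestronglyMeasurable
  · refine Eventually.of_forall fun x => Real.abs_le_sqrt ?_
    exact (le_add_of_nonneg_right (sq_nonneg (d1R h x))).trans (hM x)
  · exact (measurable_fderiv_apply_const ℝ h e1).aestronglyMeasurable
  · refine Eventually.of_forall fun x => Real.abs_le_sqrt ?_
    exact (le_add_of_nonneg_left (sq_nonneg (d0R h x))).trans (hM x)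

/-- The mass-modulated function `√(1 + t h) u`. -/
def modulate (h : Plane → ℝ) (u : Plane → ℂ) (t : ℝ) (x : Plane) : ℂ := (√(1 + t * h x) : ℝ) * u x

section Modulate

variable {h : Plane → ℝ} {C M t : ℝ}

theorem modulate_pos (hC : ∀ x, |h x| ≤ C) (ht : 0 ≤ t) (htC : t * C ≤ 1 / 2) (x : Plane) :
    1 / 2 ≤ 1 + t * h x := by
  have h1 : t * -C ≤ t * h x := mul_le_mul_of_nonneg_left (abs_le.1 (hC x)).1 ht
  linarith

theorem norm_modulate_sq (hC : ∀ x, |h x| ≤ C) (ht : 0 ≤ t) (htC : t * C ≤ 1 / 2) (x : Plane) :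
    ‖modulate h u t x‖ ^ 2 = (1 + t * h x) * ‖u x‖ ^ 2 := by
  have := modulate_pos hC ht htC x
  rw [modulate, norm_ofReal_mul_sq u (fun x => √(1 + t * h x)) x, Real.sq_sqrt (by linarith)]

theorem hasFDerivAt_sqrt_modulate (hh : Differentiable ℝ h) (hC : ∀ x, |h x| ≤ C) (ht : 0 ≤ t)
    (htC : t * C ≤ 1 / 2) (x : Plane) :
    HasFDerivAt (fun x => √(1 + t * h x))
      ((1 / (2 * √(1 + t * h x))) • (t • fderiv ℝ h x)) x := by
  have := modulate_pos hC ht htC x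
  exact (((hh x).hasFDerivAt.const_mul t).const_add 1).sqrt (by linarith)

theorem differentiable_modulate (hu : Differentiable ℝ u) (hh : Differentiable ℝ h)
    (hC : ∀ x, |h x| ≤ C) (ht : 0 ≤ t) (htC : t * C ≤ 1 / 2) :
    Differentiable ℝ (modulate h u t) := fun x =>
  ((Complex.ofRealCLM.hasFDerivAt.comp x (hasFDerivAt_sqrt_modulate hh hC ht htC x)).mul
    (hu x).hasFDerivAt).differentiableAt

theorem momentum_modulate (hu : Differentiable ℝ u) (hh : Differentiable ℝ h)
    (hC : ∀ x, |h x| ≤ C) (ht : 0 ≤ t) (htC : t * C ≤ 1 / 2) (x : Plane) :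
    momentum (modulate h u t) x = (1 + t * h x) * momentum u x := by
  have := modulate_pos hC ht htC x
  refine (momentum_ofReal_mul (hu x)
    (hasFDerivAt_sqrt_modulate hh hC ht htC x).differentiableAt).trans ?_
  rw [Real.sq_sqrt (by linarith)]

theorem gradSq_modulate_le (hu : Differentiable ℝ u) (hh : Differentiable ℝ h)
    (hC : ∀ x, |h x| ≤ C) (hM : ∀ x, gradSqR h x ≤ M) (ht : 0 ≤ t) (htC : t * C ≤ 1 / 2)
    (x : Plane) :
    gradSq (modulate h u t) x ≤ (1 + t * h x) * gradSq u x + t / 2 * crossGrad h u x +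
      t ^ 2 * (M / 2) * ‖u x‖ ^ 2 := by
  have h1 := modulate_pos hC ht htC x
  have hρ := hasFDerivAt_sqrt_modulate hh hC ht htC x
  refine (gradSq_ofReal_mul (hu x) hρ.differentiableAt).trans_le ?_
  have hs : √(1 + t * h x) ^ 2 = 1 + t * h x := Real.sq_sqrt (by linarith)
  have hs0 : 0 < √(1 + t * h x) := Real.sqrt_pos.2 (by linarith)
  have hd0 : d0R (fun x => √(1 + t * h x)) x = t * d0R h x / (2 * √(1 + t * h x)) := by
    rw [d0R, hρ.fderiv, smul_apply, smul_apply, smul_eq_mul, smul_eq_mul, d0R]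
    ring
  have hd1 : d1R (fun x => √(1 + t * h x)) x = t * d1R h x / (2 * √(1 + t * h x)) := by
    rw [d1R, hρ.fderiv, smul_apply, smul_apply, smul_eq_mul, smul_eq_mul, d1R]
    ring
  have hgrad : gradSqR (fun x => √(1 + t * h x)) x ≤ t ^ 2 * (M / 2) := by
    have : gradSqR (fun x => √(1 + t * h x)) x = t ^ 2 * (gradSqR h x / (4 * (1 + t * h x))) := by
      rw [gradSqR, hd0, hd1, gradSqR, div_pow, div_pow, mul_pow 2, hs]
      field_simp
      ring
    rw [this]
    have h0 : 0 ≤ gradSqR h x := by unfold gradSqR; positivity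
    refine mul_le_mul_of_nonneg_left ?_ (sq_nonneg t)
    rw [div_le_iff₀ (by linarith)]
    nlinarith [hM x]
  rw [hs, hd0, hd1, crossGrad]
  have : √(1 + t * h x) * (t * d0R h x / (2 * √(1 + t * h x)) * d0R (fun x => ‖u x‖ ^ 2) x +
      t * d1R h x / (2 * √(1 + t * h x)) * d1R (fun x => ‖u x‖ ^ 2) x) =
      t / 2 * (d0R h x * d0R (fun x => ‖u x‖ ^ 2) x + d1R h x * d1R (fun x => ‖u x‖ ^ 2) x) := by
    field_simp
  rw [this]
  gcongr

theorem InH.modulate (hu : InH V u) (hh : Differentiable ℝ h) (hC : ∀ x, |h x| ≤ C)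
    (hM : ∀ x, gradSqR h x ≤ M) (ht : 0 ≤ t) (htC : t * C ≤ 1 / 2) :
    InH V (modulate h u t) := by
  have hcont : Continuous fun x => 1 + t * h x := by have := hh.continuous; fun_prop
  have hbd : ∀ x, ‖1 + t * h x‖ ≤ 3 / 2 := fun x => by
    have h1 := modulate_pos hC ht htC x
    have h2 : t * h x ≤ t * C := mul_le_mul_of_nonneg_left (abs_le.1 (hC x)).2 ht
    rw [Real.norm_of_nonneg (by linarith)]
    linarith
  have hmul : ∀ {g : Plane → ℝ}, Integrable g → Integrable fun x => (1 + t * h x) * g x :=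
    fun hg => hg.bdd_mul hcont.aestronglyMeasurable (Eventually.of_forall hbd)
  refine ⟨⟨differentiable_modulate hu.1.1 hh hC ht htC, ?_, ?_⟩, ?_⟩
  · simp_rw [norm_modulate_sq hC ht htC]
    exact hmul hu.1.2.1
  · refine Integrable.mono' (((hmul hu.1.2.2).add ((hu.1.integrable_crossGrad hM).const_mul
      (t / 2))).add (hu.1.2.1.const_mul (t ^ 2 * (M / 2)))) (measurable_gradSq _).aestronglyMeasurable
      (Eventually.of_forall fun x => ?_)
    rw [Real.norm_of_nonneg (gradSq_nonneg _ _)]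
    exact gradSq_modulate_le hu.1.1 hh hC hM ht htC x
  · simp_rw [norm_modulate_sq hC ht htC]
    exact (hmul hu.2).congr (Eventually.of_forall fun x => by ring)

theorem Ea_modulate_le (hu : InH V u) (hV : V110 V) (hm : ∀ x, ‖u x‖ ^ 2 ≤ m)
    (hh : Differentiable ℝ h) (hC : ∀ x, |h x| ≤ C)
    (hM : ∀ x, gradSqR h x ≤ M) (ht : 0 ≤ t) (htC : t * C ≤ 1 / 2) :
    Ea V Ω (modulate h u t) ≤ Ea V Ω u +
      t * ((∫ x, h x * kin V Ω u x) + 1 / 2 * (∫ x, crossGrad h u x) +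
        logInt (fun x => h x * ‖u x‖ ^ 2) (fun x => ‖u x‖ ^ 2) - ∫ x, h x * ‖u x‖ ^ 4) +
      t ^ 2 * (M / 2 * (∫ x, ‖u x‖ ^ 2) +
        1 / 2 * logInt (fun x => h x * ‖u x‖ ^ 2) (fun x => h x * ‖u x‖ ^ 2)) := by
  have hbdd : ∀ {g : Plane → ℝ}, Integrable g → Integrable fun x => h x * g x :=
    fun hg => hg.bdd_mul hh.continuous.aestronglyMeasurable (Eventually.of_forall hC)
  have hkin := hu.integrable_kin hV (Ω := Ω)
  have hX := hu.1.integrable_crossGrad hM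
  have hv := hu.modulate hh hC hM ht htC
  have hf := hu.density hV hm
  have hf4 := integrable_norm_pow_four hu.1.2.1 hm
  have h1 : ∫ x, kin V Ω (modulate h u t) x ≤ (∫ x, kin V Ω u x) + t * (∫ x, h x * kin V Ω u x) +
      t / 2 * (∫ x, crossGrad h u x) + t ^ 2 * (M / 2) * ∫ x, ‖u x‖ ^ 2 := by
    have i1 : Integrable fun x => kin V Ω u x + t * (h x * kin V Ω u x) :=
      hkin.add ((hbdd hkin).const_mul t)
    have i2 : Integrable fun x => kin V Ω u x + t * (h x * kin V Ω u x) +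
        t / 2 * crossGrad h u x := i1.add (hX.const_mul _)
    rw [← integral_const_mul, ← integral_const_mul, ← integral_const_mul,
      ← integral_add hkin ((hbdd hkin).const_mul t), ← integral_add i1 (hX.const_mul _),
      ← integral_add i2 (hu.1.2.1.const_mul _)]
    refine integral_mono (hv.integrable_kin hV) (i2.add (hu.1.2.1.const_mul _)) fun x => ?_
    have := gradSq_modulate_le hu.1.1 hh hC hM ht htC x
    simp only [kin, norm_modulate_sq hC ht htC, momentum_modulate hu.1.1 hh hC ht htC]
    linarith
  have h2 : logConv (modulate h u t) = logConv u +
      2 * t * logInt (fun x => h x * ‖u x‖ ^ 2) (fun x => ‖u x‖ ^ 2) +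
      t ^ 2 * logInt (fun x => h x * ‖u x‖ ^ 2) (fun x => h x * ‖u x‖ ^ 2) := by
    have := logInt_perturb hf (hf.bdd_mul hh.continuous hC) t
    rw [logInt_eq_iterated hf hf] at this
    rw [logConv, logConv, ← this]
    simp_rw [norm_modulate_sq hC ht htC]
    congr! 5
    · ring
    · ring
  have h3 : (∫ x, ‖u x‖ ^ 4) + 2 * t * (∫ x, h x * ‖u x‖ ^ 4) ≤ ∫ x, ‖modulate h u t x‖ ^ 4 := by
    rw [← integral_const_mul, ← integral_add hf4 ((hbdd hf4).const_mul _)]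
    refine integral_mono (hf4.add ((hbdd hf4).const_mul _)) ?_ fun x => ?_
    · refine integrable_norm_pow_four hv.1.2.1 (m := 3 / 2 * m) fun x => ?_
      rw [norm_modulate_sq hC ht htC]
      have h1 := modulate_pos hC ht htC x
      have h2 : t * h x ≤ t * C := mul_le_mul_of_nonneg_left (abs_le.1 (hC x)).2 ht
      exact mul_le_mul (by linarith) (hm x) (by positivity) (by norm_num)
    · have : ‖modulate h u t x‖ ^ 4 = (‖modulate h u t x‖ ^ 2) ^ 2 := by ring
      rw [this, norm_modulate_sq hC ht htC]
      have : 0 ≤ (t * h x * ‖u x‖ ^ 2) ^ 2 := sq_nonneg _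
      simp only
      linarith
  rw [Ea_eq hv hV, Ea_eq hu hV, h2]
  linarith

theorem IsMinimizer.first_variation {a : ℝ} (hmin : IsMinimizer V Ω a u) (hV : V110 V)
    (hm : ∀ x, ‖u x‖ ^ 2 ≤ m) (hh : Differentiable ℝ h) (hC : ∀ x, |h x| ≤ C)
    (hM : ∀ x, gradSqR h x ≤ M) (hmass : ∫ x, h x * ‖u x‖ ^ 2 = 0) :
    0 ≤ (∫ x, h x * kin V Ω u x) + 1 / 2 * (∫ x, crossGrad h u x) +
        logInt (fun x => h x * ‖u x‖ ^ 2) (fun x => ‖u x‖ ^ 2) - ∫ x, h x * ‖u x‖ ^ 4 := by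
  obtain ⟨⟨hu, hua⟩, hle⟩ := hmin
  have hC0 : 0 ≤ C := (abs_nonneg _).trans (hC 0)
  set A := (∫ x, h x * kin V Ω u x) + 1 / 2 * (∫ x, crossGrad h u x) +
        logInt (fun x => h x * ‖u x‖ ^ 2) (fun x => ‖u x‖ ^ 2) - ∫ x, h x * ‖u x‖ ^ 4 with hA
  set R := M / 2 * (∫ x, ‖u x‖ ^ 2) +
        1 / 2 * logInt (fun x => h x * ‖u x‖ ^ 2) (fun x => h x * ‖u x‖ ^ 2) with hR
  have key : ∀ t : ℝ, 0 < t → t * C ≤ 1 / 2 → 0 ≤ A + t * R := fun t ht htC => by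
    have h1 := Ea_modulate_le (Ω := Ω) hu hV hm hh hC hM ht.le htC
    have h2 := hle (modulate h u t) ⟨hu.modulate hh hC hM ht.le htC, by
      simp_rw [norm_modulate_sq hC ht.le htC]
      have : ∀ x, (1 + t * h x) * ‖u x‖ ^ 2 = ‖u x‖ ^ 2 + t * (h x * ‖u x‖ ^ 2) := fun x => by ring
      simp_rw [this]
      rw [integral_add hu.1.2.1, integral_const_mul, hmass, hua, mul_zero, add_zero]
      exact (hu.1.2.1.bdd_mul hh.continuous.aestronglyMeasurable
        (Eventually.of_forall hC)).const_mul t⟩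
    rw [← hA, ← hR] at h1
    have h3 : 0 ≤ t * (A + t * R) := by nlinarith
    exact nonneg_of_mul_nonneg_right h3 ht
  have hlim : Tendsto (fun t : ℝ => A + t * R) (𝓝[>] 0) (𝓝 A) := by
    have : Tendsto (fun t : ℝ => A + t * R) (𝓝 0) (𝓝 (A + 0 * R)) :=
      Continuous.tendsto (by fun_prop) 0
    rw [zero_mul, add_zero] at this
    exact this.mono_left nhdsWithin_le_nhds
  refine ge_of_tendsto hlim ?_
  have hsmall : 0 < 1 / (2 * (C + 1)) := by positivity
  filter_upwards [Ioo_mem_nhdsGT hsmall] with t ht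
  refine key t ht.1 ?_
  calc t * C ≤ 1 / (2 * (C + 1)) * (C + 1) := by
        have := ht.2.le
        have := ht.1.le
        gcongr
        linarith
    _ = 1 / 2 := by field_simp

end Modulate

end FirstVariation

section Estimates

variable {V : Plane → ℝ} {u : Plane → ℂ} {Ω a m C : ℝ}

theorem kin_ge (hu : Differentiable ℝ u) (V : Plane → ℝ) (Ω : ℝ) (x : Plane) :
    gradAbsSq u x + (V x - Ω ^ 2 / 4 * ‖x‖ ^ 2) * ‖u x‖ ^ 2 ≤ kin V Ω u x := by
  have := gradAbsSq_le (hu x) Ω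
  rw [kin]
  linarith

theorem gradAbsSq_nonneg (u : Plane → ℂ) (x : Plane) : 0 ≤ gradAbsSq u x := sq_nonneg _

theorem gradAbsSq_le_kin (hu : Differentiable ℝ u) (hW : ∀ x, 0 ≤ V x - Ω ^ 2 / 4 * ‖x‖ ^ 2)
    (x : Plane) : gradAbsSq u x ≤ kin V Ω u x :=
  (le_add_of_nonneg_right (mul_nonneg (hW x) (sq_nonneg _))).trans (kin_ge hu V Ω x)

theorem kin_nonneg (hu : Differentiable ℝ u) (hW : ∀ x, 0 ≤ V x - Ω ^ 2 / 4 * ‖x‖ ^ 2)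
    (x : Plane) : 0 ≤ kin V Ω u x :=
  (gradAbsSq_nonneg u x).trans (gradAbsSq_le_kin hu hW x)

theorem logConv_eq_logInt (hu : InH V u) (hV : V110 V) (hm : ∀ x, ‖u x‖ ^ 2 ≤ m) :
    logConv u = logInt (fun x => ‖u x‖ ^ 2) fun x => ‖u x‖ ^ 2 :=
  (logInt_eq_iterated (hu.density hV hm) (hu.density hV hm)).symm

theorem integral_norm_pow_four_le (hm : ∀ x, ‖u x‖ ^ 2 ≤ m) {χ : Plane → ℝ}
    (hχ : ∀ x, 0 ≤ χ x) (hχu : Integrable fun x => χ x * ‖u x‖ ^ 2) :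
    ∫ x, χ x * ‖u x‖ ^ 4 ≤ m * ∫ x, χ x * ‖u x‖ ^ 2 := by
  rw [← integral_const_mul]
  refine integral_mono_of_nonneg
    (Eventually.of_forall fun x => mul_nonneg (hχ x) (by positivity)) (hχu.const_mul m)
    (Eventually.of_forall fun x => ?_)
  have := mul_le_mul_of_nonneg_right (hm x) (mul_nonneg (hχ x) (sq_nonneg ‖u x‖))
  simp only
  linarith

/-- The quadratic energy is controlled by the total energy and the maximal density. -/
theorem integral_kin_le (hu : u ∈ Sset V a) (hV : V110 V) (hm : ∀ x, ‖u x‖ ^ 2 ≤ m)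
    (hE : Ea V Ω u ≤ C) :
    ∫ x, kin V Ω u x ≤ C + ((∫ z, logNeg z) + 1) / 2 * m * a := by
  have hf := hu.1.density hV hm
  have h1 := le_logInt hf hf (fun x => sq_nonneg _) (fun x => sq_nonneg _) hm
  have h2 := integral_norm_pow_four_le (χ := fun _ => 1) hm (fun _ => zero_le_one)
    (by simpa using hu.1.1.2.1)
  simp only [one_mul] at h2
  rw [hu.2] at h1 h2
  rw [Ea_eq hu.1 hV, logConv_eq_logInt hu.1 hV hm] at hE
  linarith

/-- Minimizers with nearby masses have uniformly bounded energy. -/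
theorem IsMinimizer.exists_Ea_le {a₀ : ℝ} (ha₀ : 0 < a₀) (hmin : IsMinimizer V Ω a₀ u)
    (hV : V110 V) (hm : ∀ x, ‖u x‖ ^ 2 ≤ m) :
    ∃ C, 0 ≤ C ∧ ∀ a ∈ Icc a₀ (3 / 2 * a₀), ∀ v, IsMinimizer V Ω a v → Ea V Ω v ≤ C := by
  have hh : Differentiable ℝ fun _ : Plane => (1 : ℝ) := differentiable_const 1
  have hC : ∀ _ : Plane, |(1 : ℝ)| ≤ 1 := fun _ => by norm_num
  have hM : ∀ x : Plane, gradSqR (fun _ => (1 : ℝ)) x ≤ 0 := fun x => by simp [gradSqR, d0R, d1R]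
  have key := fun t ht ht1 => Ea_modulate_le (Ω := Ω) hmin.1.1 hV hm hh hC hM (t := t) ht ht1
  set X := (∫ x, 1 * kin V Ω u x) + 1 / 2 * (∫ x, crossGrad (fun _ => 1) u x) +
    logInt (fun x => 1 * ‖u x‖ ^ 2) (fun x => ‖u x‖ ^ 2) - ∫ x, 1 * ‖u x‖ ^ 4
  set Y := 0 / 2 * (∫ x, ‖u x‖ ^ 2) +
    1 / 2 * logInt (fun x => 1 * ‖u x‖ ^ 2) (fun x => 1 * ‖u x‖ ^ 2)
  refine ⟨|Ea V Ω u| + |X| + |Y|, by positivity, fun a ha v hv => ?_⟩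
  set t := a / a₀ - 1 with ht
  have ht0 : 0 ≤ t := sub_nonneg.2 ((one_le_div ha₀).2 ha.1)
  have ht1 : t * 1 ≤ 1 / 2 := by
    have : a / a₀ ≤ 3 / 2 := (div_le_iff₀ ha₀).2 ha.2
    linarith
  have hmem : modulate (fun _ => 1) u t ∈ Sset V a := by
    refine ⟨hmin.1.1.modulate hh hC hM ht0 ht1, ?_⟩
    simp_rw [norm_modulate_sq hC ht0 ht1]
    rw [integral_const_mul, hmin.1.2, ht]
    field_simp
    ring
  refine (hv.2 _ hmem).trans ((key t ht0 ht1).trans ?_)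
  have h1 : t * X ≤ 1 * |X| :=
    calc t * X ≤ t * |X| := mul_le_mul_of_nonneg_left (le_abs_self X) ht0
      _ ≤ 1 * |X| := mul_le_mul_of_nonneg_right (by linarith) (abs_nonneg X)
  have h2 : t ^ 2 * Y ≤ 1 * |Y| :=
    calc t ^ 2 * Y ≤ t ^ 2 * |Y| := mul_le_mul_of_nonneg_left (le_abs_self Y) (sq_nonneg t)
      _ ≤ 1 * |Y| := mul_le_mul_of_nonneg_right (by nlinarith) (abs_nonneg Y)
  have := le_abs_self (Ea V Ω u)
  linarith

/-- A weak form of `-Δ|u|² ≤ const` for minimizers, tested against bumps. -/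
theorem IsMinimizer.integral_crossGrad_le (hmin : IsMinimizer V Ω a u) (ha : 0 < a) (hV : V110 V)
    (hW : ∀ x, 0 ≤ V x - Ω ^ 2 / 4 * ‖x‖ ^ 2) (hm : ∀ x, ‖u x‖ ^ 2 ≤ m) (hC0 : 0 ≤ C)
    (hE : Ea V Ω u ≤ C) (p : Plane) {s : ℝ} (hs : 0 < s) :
    ∫ x, crossGrad (fun x => para p s x ^ 3) u x ≤
      2 * (2 * C / a + ((∫ z, logNeg z) + 1) * m) * (m * Real.pi) * s ^ 8 := by
  have hu := hmin.1.1
  have hmass := hmin.1.2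
  set f : Plane → ℝ := fun x => ‖u x‖ ^ 2 with hf_def
  set χ : Plane → ℝ := fun x => para p s x ^ 3 with hχ_def
  have hm0 : 0 ≤ m := (sq_nonneg _).trans (hm 0)
  have hκ0 : 0 ≤ ∫ z, logNeg z := integral_nonneg logNeg_nonneg
  have hf : Density f := hu.density hV hm
  have hχ0 : ∀ x, 0 ≤ χ x := fun x => pow_nonneg (para_nonneg p s x) 3
  have hχ6 : ∀ x, χ x ≤ s ^ 6 := fun x => by
    calc χ x ≤ (s ^ 2) ^ 3 := pow_le_pow_left₀ (para_nonneg p s x) (para_le p s x) 3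
      _ = s ^ 6 := by ring
  have hχabs : ∀ x, |χ x| ≤ s ^ 6 := fun x => by rw [abs_of_nonneg (hχ0 x)]; exact hχ6 x
  have hχd : Differentiable ℝ χ := fun x => (hasFDerivAt_para_cube p s x).differentiableAt
  have hχc : Continuous χ := hχd.continuous
  have hχf : Density fun x => χ x * f x := hf.bdd_mul hχc hχabs
  set c := (∫ x, χ x * f x) / a with hc_def
  have hI0 : 0 ≤ ∫ x, χ x * f x := integral_nonneg fun x => mul_nonneg (hχ0 x) (sq_nonneg _)
  have hc0 : 0 ≤ c := div_nonneg hI0 ha.le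
  set h : Plane → ℝ := fun x => c - χ x with hh_def
  have hhd : Differentiable ℝ h := hχd.const_sub c
  have hhC : ∀ x, |h x| ≤ c + s ^ 6 := fun x => by
    refine (abs_sub _ _).trans ?_
    rw [abs_of_nonneg hc0]
    linarith [hχabs x]
  have hfd : ∀ x v, fderiv ℝ h x v = -fderiv ℝ χ x v := fun x v => by
    rw [hh_def, fderiv_const_sub]; rfl
  have hgrad : ∀ g : Plane → ℝ, (∀ x v, |fderiv ℝ g x v| ≤ 6 * (s ^ 4 * (s * ‖v‖))) →
      ∀ x, gradSqR g x ≤ 2 * (6 * (s ^ 4 * (s * 1))) ^ 2 := fun g hg x => by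
    have h0 := sq_le_sq' (abs_le.1 (hg x e0)).1 (abs_le.1 (hg x e0)).2
    have h1 := sq_le_sq' (abs_le.1 (hg x e1)).1 (abs_le.1 (hg x e1)).2
    rw [norm_e0] at h0
    rw [norm_e1] at h1
    rw [gradSqR, d0R, d1R]
    linarith
  have hχM := hgrad χ fun x v => abs_fderiv_para_cube_le hs.le v x
  have hhM := hgrad h fun x v => by
    rw [hfd, abs_neg]
    exact abs_fderiv_para_cube_le hs.le v x
  have hmul : ∀ {g : Plane → ℝ}, Integrable g →
      ∫ x, h x * g x = c * (∫ x, g x) - ∫ x, χ x * g x := fun {g} hg => by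
    rw [← integral_const_mul, ← integral_sub (hg.const_mul c)
      (hg.bdd_mul hχc.aestronglyMeasurable (Eventually.of_forall hχabs))]
    refine integral_congr_ae (Eventually.of_forall fun x => ?_)
    simp only [hh_def]
    ring
  have hfv := hmin.first_variation hV hm hhd hhC hhM (by
    rw [hmul hf.integrable, hmass, hc_def, div_mul_cancel₀ _ ha.ne', sub_self])
  have hcross : ∫ x, crossGrad h u x = -∫ x, crossGrad χ u x := by
    rw [← integral_neg]
    refine integral_congr_ae (Eventually.of_forall fun x => ?_)
    simp only [crossGrad, d0R, d1R, hfd]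
    ring
  have hlog : logInt (fun x => h x * f x) f =
      c * logInt f f - logInt (fun x => χ x * f x) f := by
    rw [logInt, logInt, logInt, ← integral_const_mul,
      ← integral_sub ((integrable_logInt hf hf).const_mul c) (integrable_logInt hχf hf)]
    refine integral_congr_ae (Eventually.of_forall fun x => ?_)
    simp only [hh_def]
    ring
  rw [hmul (hu.integrable_kin hV), hmul (integrable_norm_pow_four hf.integrable hm), hcross,
    hlog] at hfv
  have h1 := le_logInt hf hχf (fun x => sq_nonneg _)
    (fun x => mul_nonneg (hχ0 x) (sq_nonneg _)) hm
  have h2 := integral_norm_pow_four_le hm hχ0 hχf.integrable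
  have h3 : 0 ≤ ∫ x, χ x * kin V Ω u x :=
    integral_nonneg fun x => mul_nonneg (hχ0 x) (kin_nonneg hu.1.1 hW x)
  have h4 : 0 ≤ c * ∫ x, kin V Ω u x :=
    mul_nonneg hc0 (integral_nonneg fun x => kin_nonneg hu.1.1 hW x)
  have h5 : c * Ea V Ω u ≤ c * C := mul_le_mul_of_nonneg_left hE hc0
  rw [Ea_eq hu hV, logConv_eq_logInt hu hV hm] at h5
  have h6 : ∫ x, crossGrad χ u x ≤
      2 * (2 * C / a + ((∫ z, logNeg z) + 1) * m) * ∫ x, χ x * f x := by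
    have : c * C = C / a * ∫ x, χ x * f x := by rw [hc_def]; ring
    rw [mul_div_assoc]
    linarith
  have h7 : ∫ x, χ x * f x ≤ m * Real.pi * s ^ 8 := by
    have h8 : ∫ x, (ball p s).indicator (fun _ => s ^ 6 * m) x = m * Real.pi * s ^ 8 := by
      rw [integral_indicator measurableSet_ball, setIntegral_const, volume_real_ball p hs.le,
        smul_eq_mul]
      ring
    rw [← h8]
    refine integral_mono hχf.integrable
      ((integrableOn_const measure_ball_lt_top.ne).integrable_indicator measurableSet_ball) fun x => ?_
    by_cases hx : x ∈ ball p s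
    · rw [indicator_of_mem hx]
      exact mul_le_mul (hχ6 x) (hm x) (sq_nonneg _) (by positivity)
    · rw [indicator_of_notMem hx]
      simp [hχ_def, para_eq_zero hs.le hx]
  refine h6.trans ?_
  rw [mul_assoc _ (m * Real.pi)]
  exact mul_le_mul_of_nonneg_left h7 (by positivity)

/-- Nonlinear concentration at a maximum point. -/
theorem IsMinimizer.mean_value (hmin : IsMinimizer V Ω a u) (ha : 0 < a) (hV : V110 V)
    (hW : ∀ x, 0 ≤ V x - Ω ^ 2 / 4 * ‖x‖ ^ 2) {p : Plane} (hm : ∀ x, ‖u x‖ ^ 2 ≤ ‖u p‖ ^ 2)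
    (hC0 : 0 ≤ C) (hE : Ea V Ω u ≤ C) {r : ℝ} (hr : 0 < r) :
    9 * Real.pi / 128 * ‖u p‖ ^ 2 ≤ (r ^ 2)⁻¹ * (∫ x in ball p r, ‖u x‖ ^ 2) +
      2 * (2 * C / a + ((∫ z, logNeg z) + 1) * ‖u p‖ ^ 2) * (‖u p‖ ^ 2 * Real.pi) * r ^ 2 / 12 := by
  have hκ0 : 0 ≤ ∫ z, logNeg z := integral_nonneg logNeg_nonneg
  have hu := hmin.1.1
  exact mean_value_inequality (differentiable_normSq hu.1.1) hu.1.2.1 hu.1.integrable_d0R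
    hu.1.integrable_d1R (fun x => sq_nonneg _) (by positivity) hr fun s hs =>
      hmin.integral_crossGrad_le ha hV hW hm hC0 hE p hs.1

theorem fderiv_normSq_eq_zero (hu : Differentiable ℝ u) {x : Plane} (hx : gradAbsSq u x = 0)
    (v : Plane) : fderiv ℝ (fun x => ‖u x‖ ^ 2) x v = 0 := by
  rw [fderiv_normSq (hu x)]
  by_cases h : u x = 0
  · simp [h]
  · have h0 : fderiv ℝ (fun y => ‖u y‖) x = 0 := norm_eq_zero.1 (pow_eq_zero_iff two_ne_zero |>.1 hx)
    rw [← fderiv_norm_mul (hu x) h, h0]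
    simp

theorem integral_gradAbsSq_pos (hu : InH1 u) {p : Plane} (hp : u p ≠ 0) :
    0 < ∫ x, gradAbsSq u x := by
  refine (integral_nonneg (gradAbsSq_nonneg u)).lt_of_ne' fun h0 => ?_
  have hae := (integral_eq_zero_iff_of_nonneg (gradAbsSq_nonneg u) hu.integrable_gradAbsSq).1 h0
  have hmv : ∀ r : ℝ, 0 < r →
      9 * Real.pi / 128 * ‖u p‖ ^ 2 ≤ (r ^ 2)⁻¹ * ∫ x, ‖u x‖ ^ 2 := fun r hr => by
    have h1 := mean_value_inequality (p := p) (differentiable_normSq hu.1) hu.2.1 hu.integrable_d0R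
      hu.integrable_d1R (fun x => sq_nonneg _) le_rfl hr fun s _ => by
        rw [zero_mul]
        refine (integral_eq_zero_of_ae (hae.mono fun x hx => ?_)).le
        simp [d0R, d1R, fderiv_normSq_eq_zero hu.1 hx]
    rw [zero_mul, zero_div, add_zero] at h1
    exact h1.trans (mul_le_mul_of_nonneg_left
      (setIntegral_le_integral hu.2.1 (Eventually.of_forall fun x => sq_nonneg _)) (by positivity))
  have hlim : Tendsto (fun r : ℝ => (r ^ 2)⁻¹ * ∫ x, ‖u x‖ ^ 2) atTop (𝓝 0) := by
    simpa using (tendsto_inv_atTop_zero.comp (tendsto_pow_atTop (two_ne_zero (α := ℕ)))).mul_const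
      (∫ x, ‖u x‖ ^ 2)
  have hle := ge_of_tendsto hlim ((eventually_gt_atTop 0).mono hmv)
  have : 0 < 9 * Real.pi / 128 * ‖u p‖ ^ 2 := by positivity
  linarith

theorem SubCritical.tendsInfty (hsub : SubCritical V Ω) (hΩ : 0 < Ω) :
    TendsInfty fun x => V x - Ω ^ 2 / 4 * ‖x‖ ^ 2 := by
  obtain ⟨W, ⟨-, hW⟩, hlt⟩ := hsub
  refine fun M => (hW M).imp fun R hR x hx => (hR x hx).trans ?_
  simp only
  gcongr

/-- Confinement bounds the maximal density from below. -/
theorem half_le_density (hu : u ∈ Sset V a) (hV : V110 V)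
    (hW : ∀ x, 0 ≤ V x - Ω ^ 2 / 4 * ‖x‖ ^ 2) {B R : ℝ} (hB : 0 < B) (hR : 0 ≤ R)
    (hVR : ∀ x, R ≤ ‖x‖ → B ≤ V x - Ω ^ 2 / 4 * ‖x‖ ^ 2) (hm : ∀ x, ‖u x‖ ^ 2 ≤ m)
    (hk : ∫ x, kin V Ω u x ≤ B * (a / 2)) : a / 2 ≤ Real.pi * R ^ 2 * m := by
  have hind : Integrable ((ball (0 : Plane) R).indicator fun _ => m) :=
    (integrableOn_const measure_ball_lt_top.ne).integrable_indicator measurableSet_ball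
  have hkin := (hu.1.integrable_kin hV (Ω := Ω)).const_mul B⁻¹
  have h1 : ∫ x, ‖u x‖ ^ 2 ≤ ∫ x, ((ball (0 : Plane) R).indicator (fun _ => m) x +
      B⁻¹ * kin V Ω u x) := by
    refine integral_mono hu.1.1.2.1 (hind.add hkin) fun x => ?_
    have hk0 := kin_nonneg hu.1.1.1 hW x
    by_cases hx : x ∈ ball (0 : Plane) R
    · simp only [indicator_of_mem hx]
      have : 0 ≤ B⁻¹ * kin V Ω u x := by positivity
      linarith [hm x]
    · simp only [indicator_of_notMem hx, zero_add]
      rw [mem_ball_zero_iff, not_lt] at hx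
      rw [inv_mul_eq_div, le_div_iff₀ hB]
      have h2 := kin_ge hu.1.1.1 V Ω x
      have h3 := gradAbsSq_nonneg u x
      have h4 := mul_le_mul_of_nonneg_right (hVR x hx) (sq_nonneg ‖u x‖)
      linarith
  rw [hu.2, integral_add hind hkin, integral_indicator measurableSet_ball, setIntegral_const,
    volume_real_ball 0 hR, smul_eq_mul, integral_const_mul] at h1
  have h2 : B⁻¹ * ∫ x, kin V Ω u x ≤ a / 2 := by
    rw [inv_mul_eq_div, div_le_iff₀ hB]
    linarith
  linarith

end Estimates

theorem setIntegral_norm_wfam_sq (Ω : ℝ) (u : ℝ → Plane → ℂ) (xa : ℝ → Plane) {a : ℝ} (θv : ℝ)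
    (hε : 0 < epsOf u a) :
    ∫ y in ball (0 : Plane) 2, ‖wfam Ω u xa a θv y‖ ^ 2 =
      ∫ x in ball (xa a) (2 * epsOf u a), ‖u a x‖ ^ 2 := by
  set ε := epsOf u a
  have hw : ∀ y, ‖wfam Ω u xa a θv y‖ ^ 2 = ε ^ 2 * ‖u a (ε • y + xa a)‖ ^ 2 := fun y => by
    rw [wfam, norm_mul, norm_mul, neg_mul, mul_comm Complex.I, ← neg_mul, ← Complex.ofReal_neg,
      Complex.norm_exp_ofReal_mul_I, mul_one, mul_pow, Complex.norm_real, Real.norm_eq_abs, sq_abs]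
  set F : Plane → ℝ := (ball (xa a) (2 * ε)).indicator fun x => ‖u a x‖ ^ 2 with hF
  have hmem : ∀ y, ε • y + xa a ∈ ball (xa a) (2 * ε) ↔ y ∈ ball (0 : Plane) 2 := fun y => by
    rw [mem_ball_iff_norm, add_sub_cancel_right, norm_smul, Real.norm_of_nonneg hε.le,
      mem_ball_zero_iff, mul_comm, mul_lt_mul_iff_left₀ hε]
  have hind : ∀ y, (ball (0 : Plane) 2).indicator (fun y => ‖wfam Ω u xa a θv y‖ ^ 2) y =
      ε ^ 2 * F (ε • y + xa a) := fun y => by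
    by_cases hy : y ∈ ball (0 : Plane) 2
    · rw [indicator_of_mem hy, hF, indicator_of_mem ((hmem y).2 hy), hw]
    · rw [indicator_of_notMem hy, hF, indicator_of_notMem (mt (hmem y).1 hy), mul_zero]
  rw [← integral_indicator measurableSet_ball, ← integral_indicator measurableSet_ball]
  simp_rw [hind]
  rw [integral_const_mul, Measure.integral_comp_smul volume (fun y => F (y + xa a)) ε,
    integral_add_right_eq_self F, finrank_euclideanSpace_fin, smul_eq_mul,
    abs_of_pos (by positivity), ← mul_assoc, mul_inv_cancel₀ (by positivity), one_mul]

/-- Minimizers with bounded energy carry a fixed amount of mass near a maximum point, at the scale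
given by the Dirichlet energy of the modulus. -/
theorem exists_concentration {V : Plane → ℝ} {Ω a₀ A C : ℝ} (hV : V110 V)
    (hW : ∀ x, 0 ≤ V x - Ω ^ 2 / 4 * ‖x‖ ^ 2)
    (hinf : TendsInfty fun x => V x - Ω ^ 2 / 4 * ‖x‖ ^ 2) (ha₀ : 0 < a₀) (hA : a₀ ≤ A)
    (hC0 : 0 ≤ C) :
    ∃ η, 0 < η ∧ ∀ a ∈ Icc a₀ A, ∀ u p, IsMinimizer V Ω a u → Ea V Ω u ≤ C →
      (∀ x, ‖u x‖ ≤ ‖u p‖) → 0 < (∫ x, gradAbsSq u x) ∧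
        η ≤ ∫ x in ball p (2 * (∫ x, gradAbsSq u x) ^ (-(1 : ℝ) / 2)), ‖u x‖ ^ 2 := by
  set κ := ∫ z, logNeg z
  have hκ : 0 ≤ κ := integral_nonneg logNeg_nonneg
  set C₁ := C + (κ + 1) / 2 * A + 1 with hC₁_def
  have hA0 : 0 < A := ha₀.trans_le hA
  have hC₁ : 0 < C₁ := by positivity
  obtain ⟨R₀, hR₀⟩ := hinf (2 * C₁ / a₀)
  set R := max R₀ 0
  set m₀ := min 1 (a₀ / 2 / (Real.pi * R ^ 2 + 1)) with hm₀_def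
  have hm₀ : 0 < m₀ := by positivity
  set K := 2 * Real.pi * (2 * C / a₀ + κ + 1) with hK_def
  have hK : 0 < K := by positivity
  set δ := min (4 / C₁) (27 * Real.pi / (64 * K)) with hδ_def
  have hδ : 0 < δ := by positivity
  have hδ1 : δ * C₁ ≤ 4 := (le_div_iff₀ hC₁).1 (min_le_left _ _)
  have hδ2 : δ * (64 * K) ≤ 27 * Real.pi := (le_div_iff₀ (by positivity)).1 (min_le_right _ _)
  refine ⟨δ * (9 * Real.pi / 256) * (m₀ / (m₀ + 1)), by positivity,
    fun a ha u p hmin hE hmax => ?_⟩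
  have ha0 : 0 < a := ha₀.trans_le ha.1
  have hu := hmin.1.1
  have hm : ∀ x, ‖u x‖ ^ 2 ≤ ‖u p‖ ^ 2 := fun x => pow_le_pow_left₀ (norm_nonneg _) (hmax x) 2
  set m := ‖u p‖ ^ 2 with hm_def
  have hm_nonneg : 0 ≤ m := sq_nonneg _
  have hkin := integral_kin_le hmin.1 hV hm hE
  have hkin' : ∫ x, kin V Ω u x ≤ C₁ * (m + 1) := by
    have h1 : (κ + 1) / 2 * m * a ≤ (κ + 1) / 2 * m * A :=
      mul_le_mul_of_nonneg_left ha.2 (by positivity)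
    have h2 : 0 ≤ C * m := by positivity
    have h3 : 0 ≤ (κ + 1) / 2 * A := by positivity
    rw [hC₁_def]
    linarith
  have hm_lower : m₀ ≤ m := by
    by_contra! hlt
    have hm1 : m ≤ 1 := hlt.le.trans (min_le_left _ _)
    have hk : ∫ x, kin V Ω u x ≤ 2 * C₁ / a₀ * (a / 2) := by
      have h1 : (κ + 1) / 2 * m * a ≤ (κ + 1) / 2 * 1 * A := by
        have := ha.2
        gcongr
      have h2 : C₁ = 2 * C₁ / a₀ * (a₀ / 2) := by field_simp
      have h3 : 2 * C₁ / a₀ * (a₀ / 2) ≤ 2 * C₁ / a₀ * (a / 2) := by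
        have := ha.1
        gcongr
      linarith
    have h1 := half_le_density hmin.1 hV hW (by positivity) (le_max_right R₀ 0)
      (fun x hx => hR₀ x ((le_max_left _ _).trans hx)) hm hk
    have h2 : a₀ / 2 / (Real.pi * R ^ 2 + 1) ≤ m := by
      rw [div_le_iff₀ (by positivity)]
      linarith [ha.1]
    exact hlt.not_ge ((min_le_right _ _).trans h2)
  have hm_pos : 0 < m := hm₀.trans_le hm_lower
  have hG : 0 < ∫ x, gradAbsSq u x :=
    integral_gradAbsSq_pos hu.1 (p := p) fun h => by simp [hm_def, h] at hm_pos
  refine ⟨hG, ?_⟩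
  set G := ∫ x, gradAbsSq u x
  have hGle : G ≤ C₁ * (m + 1) :=
    (integral_mono hu.1.integrable_gradAbsSq (hu.integrable_kin hV)
      (gradAbsSq_le_kin hu.1.1 hW)).trans hkin'
  set r := √(δ / (m + 1))
  have hr : 0 < r := Real.sqrt_pos.2 (by positivity)
  have hr2 : r ^ 2 = δ / (m + 1) := Real.sq_sqrt (by positivity)
  have hmv := hmin.mean_value ha0 hV hW hm hC0 hE hr
  rw [← hm_def, ← show κ = ∫ z, logNeg z from rfl] at hmv
  have herr : 2 * (2 * C / a + (κ + 1) * m) * (m * Real.pi) * r ^ 2 / 12 ≤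
      9 * Real.pi / 256 * m := by
    have h1 : 2 * C / a ≤ 2 * C / a₀ := by
      have := ha.1
      gcongr
    have h2 : 2 * C / a + (κ + 1) * m ≤ (2 * C / a₀ + κ + 1) * (m + 1) := by
      have : 0 ≤ 2 * C / a₀ * m := by positivity
      linarith
    calc 2 * (2 * C / a + (κ + 1) * m) * (m * Real.pi) * r ^ 2 / 12
        ≤ 2 * ((2 * C / a₀ + κ + 1) * (m + 1)) * (m * Real.pi) * r ^ 2 / 12 := by gcongr
      _ = δ * (64 * K) * (m / 768) := by rw [hr2, hK_def]; field_simp; ring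
      _ ≤ 27 * Real.pi * (m / 768) := by gcongr
      _ = 9 * Real.pi / 256 * m := by ring
  have hmass : r ^ 2 * (9 * Real.pi / 256 * m) ≤ ∫ x in ball p r, ‖u x‖ ^ 2 := by
    rw [← le_inv_mul_iff₀ (by positivity)]
    linarith
  have hrG : r ≤ 2 * G ^ (-(1 : ℝ) / 2) := by
    have h1 : (G ^ (-(1 : ℝ) / 2)) ^ 2 = G⁻¹ := by
      rw [← Real.rpow_natCast, ← Real.rpow_mul hG.le, ← Real.rpow_neg_one]
      norm_num
    refine le_of_sq_le_sq ?_ (by positivity)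
    rw [hr2, mul_pow, h1, ← div_eq_mul_inv, div_le_div_iff₀ (by positivity) hG]
    calc δ * G ≤ δ * (C₁ * (m + 1)) := by gcongr
      _ = δ * C₁ * (m + 1) := by ring
      _ ≤ 2 ^ 2 * (m + 1) := by gcongr; linarith
  calc δ * (9 * Real.pi / 256) * (m₀ / (m₀ + 1))
      ≤ δ * (9 * Real.pi / 256) * (m / (m + 1)) := by
        refine mul_le_mul_of_nonneg_left ?_ (by positivity)
        rw [div_le_div_iff₀ (by positivity) (by positivity)]
        linarith
    _ = r ^ 2 * (9 * Real.pi / 256 * m) := by rw [hr2]; ring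
    _ ≤ ∫ x in ball p r, ‖u x‖ ^ 2 := hmass
    _ ≤ _ := setIntegral_mono_set hu.1.2.1.integrableOn
        (Eventually.of_forall fun x => sq_nonneg _) (ball_subset_ball hrG).eventuallyLE

theorem no_vanishing_of_rescaled_minimizers
    (V : Plane → ℝ) (Ω α : ℝ) (Q : Plane → ℝ)
    (hV : V110 V) (hΩ : 0 < Ω) (hsub : SubCritical V Ω) (hCV : CondV V Ω α)
    (hQ : IsGroundState Q)
    (astar : ℝ) (hastar : astar = ∫ x : Plane, (Q x) ^ 2)
    (u : ℝ → Plane → ℂ)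
    (hmin : ∀ a ∈ Ioo (0 : ℝ) astar, IsMinimizer V Ω a (u a))
    (xa : ℝ → Plane) (θ : ℝ → ℝ)
    (hxa : ∀ a ∈ Ioo (0 : ℝ) astar, ∀ y : Plane, ‖u a y‖ ≤ ‖u a (xa a)‖)
    (hθ : ∀ a, θ a ∈ Ico (0 : ℝ) (2 * Real.pi))
 :
    ∃ η : ℝ, 0 < η ∧ ∀ᶠ a in 𝓝[<] astar,
      η ≤ ∫ y in ball (0 : Plane) 2, ‖wfam Ω u xa a (θ a) y‖ ^ 2 := by
  have hA : 0 < astar := by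
    obtain ⟨-, hQpos, -, hQint, -⟩ := hQ
    rw [hastar, integral_pos_iff_support_of_nonneg (fun x => sq_nonneg _) hQint]
    have : (Function.support fun x => Q x ^ 2) = univ :=
      eq_univ_of_forall fun x => (pow_pos (hQpos x) 2).ne'
    rw [this]
    exact Measure.measure_univ_pos.2 (NeZero.ne volume)
  have hsq : ∀ a ∈ Ioo (0 : ℝ) astar, ∀ y, ‖u a y‖ ^ 2 ≤ ‖u a (xa a)‖ ^ 2 := fun a ha y =>
    pow_le_pow_left₀ (norm_nonneg _) (hxa a ha y) 2
  have ha₀ : 2 / 3 * astar ∈ Ioo 0 astar := ⟨by positivity, by linarith⟩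
  obtain ⟨C, hC0, hC⟩ := (hmin _ ha₀).exists_Ea_le ha₀.1 hV (hsq _ ha₀)
  obtain ⟨η, hη, h⟩ := exists_concentration hV hCV.2.1 (hsub.tendsInfty hΩ) ha₀.1 ha₀.2.le hC0
  refine ⟨η, hη, ?_⟩
  filter_upwards [Ioo_mem_nhdsLT ha₀.2] with a ha
  have ha' : a ∈ Ioo 0 astar := ⟨ha₀.1.trans ha.1, ha.2⟩
  have hE := hC a ⟨ha.1.le, by linarith [ha.2]⟩ _ (hmin a ha')
  obtain ⟨hG, hle⟩ := h a ⟨ha.1.le, ha.2.le⟩ _ _ (hmin a ha') hE (hxa a ha')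
  rw [setIntegral_norm_wfam_sq Ω u xa (θ a) (Real.rpow_pos_of_pos hG _)]
  exact hle

end
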